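/- Assume Conditions B1–B2. Given a finite (ε/b)-regular discretization T̃ = {t₁,…,t_M} of T, set X = (f(t₁),…,f(t_M)), let Q be the probability measure Q(X ∈ B) = (1/M) Σ_{i=1}^M P(X ∈ B | X_i > b − 1/b), and define L̃_b = M·P(X₁ > b − 1/b) / (Σ_{j=1}^M 1(X_j > b − 1/b)) · 1(max_{1≤i≤M} X_i > b). Then there exist constants c, b₀ and ε₀ > 0 such that for all b > b₀, all ε ∈ (0, ε₀], and all (ε/b)-regular discretizations T̃ of T, E^Q[ L̃_b² ] ≤ c · P( sup_{t∈T̃} f(t) > b )² ≤ c · P( sup_{t∈T} f(t) > b )² · (indeed E^Q[L̃_b²]/P(sup_{t∈T} f(t) > b)² ≤ E^Q[L̃_b²]/P(sup_{t∈T̃} f(t) > b)² ≤ c uniformly). -/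

import Mathlib

open MeasureTheory ProbabilityTheory Filter
open scoped Classical

noncomputable section

/-- The ℓ¹ norm `|x| = ∑ⱼ |xⱼ|` on `ℝ^d`. -/
def nrm {d : ℕ} (x : Fin d → ℝ) : ℝ := ∑ j, |x j|

section FieldTheory

open scoped ENNReal NNReal Topology

variable {Ω : Type} [MeasureSpace Ω] {d : ℕ}

/-- A centered, unit-variance, homogeneous Gaussian field with almost surely `C²` paths. -/
structure IsHomGaussField (f : (Fin d → ℝ) → Ω → ℝ) : Prop where
  meas : ∀ t, Measurable (f t)
  gauss : ∀ (n : ℕ) (t : Fin n → (Fin d → ℝ)) (c : Fin n → ℝ),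
    ∃ v : NNReal, Measure.map (fun ω => ∑ i, c i * f (t i) ω) (ℙ : Measure Ω) = gaussianReal 0 v
  unit_var : (∫ ω, (f 0 ω) ^ 2) = 1
  stat : ∀ (n : ℕ) (t : Fin n → (Fin d → ℝ)) (h : Fin d → ℝ),
    Measure.map (fun ω (i : Fin n) => f (t i + h) ω) (ℙ : Measure Ω) =
      Measure.map (fun ω (i : Fin n) => f (t i) ω) (ℙ : Measure Ω)
  smooth : ∀ᵐ ω ∂(ℙ : Measure Ω), ContDiff ℝ 2 (fun t => f t ω)

namespace IsHomGaussField

variable {f : (Fin d → ℝ) → Ω → ℝ}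

/-- The covariance function of a homogeneous field. -/
def cov (f : (Fin d → ℝ) → Ω → ℝ) (h : Fin d → ℝ) : ℝ := ∫ ω, f 0 ω * f h ω

lemma exists_map_eq_gaussianReal (hf : IsHomGaussField f) {ι : Type*} [Fintype ι]
    (t : ι → (Fin d → ℝ)) (c : ι → ℝ) :
    ∃ v : NNReal, Measure.map (fun ω => ∑ i, c i * f (t i) ω) (ℙ : Measure Ω)
      = gaussianReal 0 v := by
  obtain ⟨v, hv⟩ := hf.gauss (Fintype.card ι) (t ∘ (Fintype.equivFin ι).symm)
    (c ∘ (Fintype.equivFin ι).symm)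
  refine ⟨v, hv ▸ ?_⟩
  congr 1
  ext ω
  exact ((Fintype.equivFin ι).symm.sum_comp fun i => c i * f (t i) ω).symm

lemma hasGaussianLaw_pi (hf : IsHomGaussField f) {ι : Type*} [Fintype ι] {J : ι → Type*}
    [∀ i, Fintype (J i)] (t : ∀ i, J i → (Fin d → ℝ)) (c : ∀ i, J i → ℝ) :
    HasGaussianLaw (fun ω (i : ι) => ∑ j, c i j * f (t i j) ω) (ℙ : Measure Ω) := by
  have hmeas : ∀ i, Measurable fun ω => ∑ j, c i j * f (t i j) ω := fun i =>
    Finset.measurable_sum _ fun j _ => (hf.meas _).const_mul _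
  refine ⟨isGaussian_of_map_eq_gaussianReal fun L => ⟨0, ?_⟩⟩
  obtain ⟨v, hv⟩ := hf.exists_map_eq_gaussianReal (ι := Σ i, J i) (fun p => t p.1 p.2)
    (fun p => L (Pi.single p.1 1) * c p.1 p.2)
  refine ⟨v, ?_⟩
  rw [Measure.map_map (by fun_prop) (measurable_pi_lambda _ hmeas), ← hv]
  congr 1
  ext ω
  rw [Fintype.sum_sigma, Function.comp_apply]
  conv_lhs => rw [pi_eq_sum_univ' (fun i => ∑ j, c i j * f (t i j) ω), map_sum]
  refine Finset.sum_congr rfl fun i _ => ?_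
  rw [map_smul, smul_eq_mul, Finset.sum_mul]
  refine Finset.sum_congr rfl fun j _ => ?_
  ring

lemma isGaussianProcess_comb (hf : IsHomGaussField f) {S : Type*} {J : S → Type*}
    [∀ i, Fintype (J i)] (t : ∀ i, J i → (Fin d → ℝ)) (c : ∀ i, J i → ℝ) :
    IsGaussianProcess (fun i ω => ∑ j, c i j * f (t i j) ω) (ℙ : Measure Ω) where
  hasGaussianLaw I := hf.hasGaussianLaw_pi (fun i : I => t i) (fun i : I => c i)

lemma memLp_two (hf : IsHomGaussField f) (t : Fin d → ℝ) : MemLp (f t) 2 (ℙ : Measure Ω) := by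
  have h := (hf.hasGaussianLaw_pi (ι := Fin 1) (J := fun _ => Fin 1) (fun _ _ => t)
    (fun _ _ => 1)).eval 0
  simpa using h.memLp_two

lemma integrable_mul (hf : IsHomGaussField f) (s t : Fin d → ℝ) :
    Integrable (fun ω => f s ω * f t ω) (ℙ : Measure Ω) :=
  (hf.memLp_two s).integrable_mul (hf.memLp_two t)

lemma integral_comb_eq_zero (hf : IsHomGaussField f) {ι : Type*} [Fintype ι]
    (t : ι → (Fin d → ℝ)) (c : ι → ℝ) :
    ∫ ω, ∑ i, c i * f (t i) ω = 0 := by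
  obtain ⟨v, hv⟩ := hf.exists_map_eq_gaussianReal t c
  have h := integral_map (μ := (ℙ : Measure Ω)) (φ := fun ω => ∑ i, c i * f (t i) ω)
    (f := fun x : ℝ => x)
    (Finset.measurable_sum _ fun j _ => (hf.meas _).const_mul _).aemeasurable
    (by fun_prop)
  rw [← h, hv]
  simp

lemma integral_mul_eq_cov (hf : IsHomGaussField f) (s t : Fin d → ℝ) :
    ∫ ω, f s ω * f t ω = cov f (t - s) := by
  have h := hf.stat 2 ![0, t - s] s
  have h1 := integral_map (μ := (ℙ : Measure Ω))
    (φ := fun ω (i : Fin 2) => f ((![0, t - s] : Fin 2 → Fin d → ℝ) i + s) ω)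
    (f := fun x : Fin 2 → ℝ => x 0 * x 1)
    (measurable_pi_lambda _ fun i => hf.meas _).aemeasurable
    (by fun_prop)
  have h2 := integral_map (μ := (ℙ : Measure Ω))
    (φ := fun ω (i : Fin 2) => f ((![0, t - s] : Fin 2 → Fin d → ℝ) i) ω)
    (f := fun x : Fin 2 → ℝ => x 0 * x 1)
    (measurable_pi_lambda _ fun i => hf.meas _).aemeasurable
    (by fun_prop)
  rw [h, h2] at h1
  simpa [cov] using h1.symm

lemma cov_zero (hf : IsHomGaussField f) : cov f 0 = 1 := by
  rw [← hf.unit_var]; simp [cov, sq]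

lemma integral_sq (hf : IsHomGaussField f) (t : Fin d → ℝ) : ∫ ω, f t ω ^ 2 = 1 := by
  simp_rw [sq]; rw [hf.integral_mul_eq_cov, sub_self, hf.cov_zero]

lemma map_comb (hf : IsHomGaussField f) {ι : Type*} [Fintype ι]
    (t : ι → (Fin d → ℝ)) (c : ι → ℝ) :
    Measure.map (fun ω => ∑ i, c i * f (t i) ω) (ℙ : Measure Ω)
      = gaussianReal 0 (∫ ω, (∑ i, c i * f (t i) ω) ^ 2).toNNReal := by
  obtain ⟨v, hv⟩ := hf.exists_map_eq_gaussianReal t c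
  have h := integral_map (μ := (ℙ : Measure Ω)) (φ := fun ω => ∑ i, c i * f (t i) ω)
    (f := fun x : ℝ => x ^ 2)
    (Finset.measurable_sum _ fun j _ => (hf.meas _).const_mul _).aemeasurable
    (by fun_prop)
  rw [← h, hv]
  have h3 := variance_fun_id_gaussianReal (μ := 0) (v := v)
  rw [variance_eq_integral (by fun_prop)] at h3
  simp only [integral_id_gaussianReal, sub_zero] at h3
  rw [h3]; simp

lemma map_eq_gaussianReal (hf : IsHomGaussField f) (t : Fin d → ℝ) :
    Measure.map (f t) (ℙ : Measure Ω) = gaussianReal 0 1 := by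
  have h := hf.map_comb (ι := Fin 1) (fun _ => t) (fun _ => 1)
  simpa [hf.integral_sq] using h

lemma integral_add_sq (hf : IsHomGaussField f) (s t : Fin d → ℝ) :
    ∫ ω, (f s ω + f t ω) ^ 2 = 2 + 2 * cov f (t - s) := by
  have e : ∀ ω, (f s ω + f t ω) ^ 2 = f s ω * f s ω + 2 * (f s ω * f t ω) + f t ω * f t ω :=
    fun ω => by ring
  simp_rw [e]
  have i1 := hf.integrable_mul s s
  have i2 := (hf.integrable_mul s t).const_mul 2
  have i3 := hf.integrable_mul t t
  have i12 : Integrable (fun ω => f s ω * f s ω + 2 * (f s ω * f t ω)) (ℙ : Measure Ω) := i1.add i2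
  rw [integral_add i12 i3, integral_add i1 i2, integral_const_mul]
  simp only [hf.integral_mul_eq_cov, sub_self, hf.cov_zero]
  ring

lemma integral_sub_sq (hf : IsHomGaussField f) (s t : Fin d → ℝ) :
    ∫ ω, (f s ω - f t ω) ^ 2 = 2 - 2 * cov f (t - s) := by
  have e : ∀ ω, (f s ω - f t ω) ^ 2 = f s ω * f s ω - 2 * (f s ω * f t ω) + f t ω * f t ω :=
    fun ω => by ring
  simp_rw [e]
  have i1 := hf.integrable_mul s s
  have i2 := (hf.integrable_mul s t).const_mul 2
  have i3 := hf.integrable_mul t t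
  have i12 : Integrable (fun ω => f s ω * f s ω - 2 * (f s ω * f t ω)) (ℙ : Measure Ω) := i1.sub i2
  rw [integral_add i12 i3, integral_sub i1 i2, integral_const_mul]
  simp only [hf.integral_mul_eq_cov, sub_self, hf.cov_zero]
  ring

lemma map_add_eq_gaussianReal (hf : IsHomGaussField f) (s t : Fin d → ℝ) :
    Measure.map (fun ω => f s ω + f t ω) (ℙ : Measure Ω)
      = gaussianReal 0 (2 + 2 * cov f (t - s)).toNNReal := by
  simpa [Fin.sum_univ_two, hf.integral_add_sq] using hf.map_comb (ι := Fin 2) ![s, t] (fun _ => 1)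

lemma cov_le_one (hf : IsHomGaussField f) (h : Fin d → ℝ) : cov f h ≤ 1 := by
  have h1 : 0 ≤ ∫ ω, (f 0 ω - f h ω) ^ 2 := integral_nonneg fun ω => sq_nonneg _
  rw [hf.integral_sub_sq, sub_zero] at h1
  linarith

lemma abs_cov_le_one (hf : IsHomGaussField f) (h : Fin d → ℝ) : |cov f h| ≤ 1 := by
  refine abs_le.2 ⟨?_, hf.cov_le_one h⟩
  have h1 : 0 ≤ ∫ ω, (f 0 ω + f h ω) ^ 2 := integral_nonneg fun ω => sq_nonneg _
  rw [hf.integral_add_sq, sub_zero] at h1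
  linarith

/-- The residual of the field around `y` after regression on its value at `y`. -/
def resid (f : (Fin d → ℝ) → Ω → ℝ) (y : Fin d → ℝ) (ω : Ω) (x : Fin d → ℝ) : ℝ :=
  f (y + x) ω - cov f x * f y ω

lemma indepFun_resid (hf : IsHomGaussField f) (y : Fin d → ℝ) :
    IndepFun (f y) (resid f y) (ℙ : Measure Ω) := by
  have hp : IsProbabilityMeasure (ℙ : Measure Ω) :=
    (hf.hasGaussianLaw_pi (ι := Fin 1) (J := fun _ => Fin 1) (fun _ _ => y)
      (fun _ _ => 1)).isProbabilityMeasure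
  have hG := hf.isGaussianProcess_comb (S := Unit ⊕ (Fin d → ℝ)) (J := fun _ => Fin 2)
    (fun i => Sum.elim (fun _ => ![y, y]) (fun x => ![y + x, y]) i)
    (fun i => Sum.elim (fun _ => ![1, 0]) (fun x => ![1, -cov f x]) i)
  have hE : (fun (i : Unit ⊕ (Fin d → ℝ)) (ω : Ω) => ∑ j : Fin 2,
      (Sum.elim (fun _ => ![1, 0]) (fun x => ![1, -cov f x]) i : Fin 2 → ℝ) j *
      f ((Sum.elim (fun _ => ![y, y]) (fun x => ![y + x, y]) i : Fin 2 → Fin d → ℝ) j) ω)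
      = Sum.elim (fun (_ : Unit) ω => f y ω) (fun x ω => resid f y ω x) := by
    ext i ω
    rcases i with i | x
    · simp
    · simp [resid, Fin.sum_univ_two, sub_eq_add_neg]
  rw [hE] at hG
  have mR : ∀ x, Measurable fun ω => resid f y ω x := fun x =>
    (hf.meas _).sub ((hf.meas _).const_mul _)
  have h := hG.indepFun_of_covariance_eq_zero (fun _ => (hf.meas y).aemeasurable)
    (fun x => (mR x).aemeasurable) fun _ x => ?_
  · exact h.comp (φ := fun g : Unit → ℝ => g ()) (ψ := id) (measurable_pi_apply _) measurable_id
  · have m1 : MemLp (fun ω => resid f y ω x) 2 (ℙ : Measure Ω) :=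
      (hf.memLp_two _).sub ((hf.memLp_two _).const_mul _)
    have h0 := hf.integral_comb_eq_zero (ι := Fin 1) (fun _ => y) (fun _ => 1)
    simp only [Finset.univ_unique, one_mul, Finset.sum_const, Finset.card_singleton,
      one_smul] at h0
    rw [covariance_eq_sub (hf.memLp_two y) m1, h0, zero_mul, sub_zero]
    have e : ∀ ω, (f y * fun ω => resid f y ω x) ω
        = f y ω * f (y + x) ω - cov f x * (f y ω * f y ω) := fun ω => by
      simp only [resid, Pi.mul_apply]; ring
    simp_rw [e]
    rw [integral_sub (hf.integrable_mul _ _) ((hf.integrable_mul _ _).const_mul _),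
      integral_const_mul, hf.integral_mul_eq_cov, hf.integral_mul_eq_cov]
    simp [hf.cov_zero]

end IsHomGaussField

end FieldTheory

section LipschitzModulus

open scoped ENNReal NNReal Topology

variable {d : ℕ}

/-- The difference quotient of `φ` at the `n`-th of a dense sequence of pairs of points, provided
that this pair consists of two distinct points of the ball of radius `R`. -/
def slopeSeq (R : ℝ) (φ : (Fin d → ℝ) → ℝ) (n : ℕ) : ℝ :=
  let p := TopologicalSpace.denseSeq ((Fin d → ℝ) × (Fin d → ℝ)) n
  if ‖p.1‖ < R ∧ ‖p.2‖ < R ∧ p.1 ≠ p.2 then (φ p.1 - φ p.2) / ‖p.1 - p.2‖ else 0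

/-- The supremum of the difference quotients `slopeSeq`, which is the Lipschitz constant of `φ` on
the ball of radius `R` if `φ` is continuous. -/
def lipConst (R : ℝ) (φ : (Fin d → ℝ) → ℝ) : ℝ≥0∞ := ⨆ n, ‖slopeSeq R φ n‖ₑ

lemma abs_slopeSeq_le {R : ℝ} {φ : (Fin d → ℝ) → ℝ} (h : lipConst R φ ≠ ∞) (n : ℕ) :
    |slopeSeq R φ n| ≤ (lipConst R φ).toReal := by
  have h1 : ‖slopeSeq R φ n‖ₑ ≤ lipConst R φ := le_iSup (fun n => ‖slopeSeq R φ n‖ₑ) n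
  have h2 := ENNReal.toReal_mono h h1
  simpa using h2

lemma abs_sub_le_lipConst {R : ℝ} {φ : (Fin d → ℝ) → ℝ} (hφ : Continuous φ)
    (h : lipConst R φ ≠ ∞) {x y : Fin d → ℝ} (hx : ‖x‖ < R) (hy : ‖y‖ < R) :
    |φ x - φ y| ≤ (lipConst R φ).toReal * ‖x - y‖ := by
  by_cases hxy : x = y
  · simp [hxy]
  set S : Set ((Fin d → ℝ) × (Fin d → ℝ)) := {p | ‖p.1‖ < R ∧ ‖p.2‖ < R ∧ p.1 ≠ p.2} with hS
  have hSo : IsOpen S := by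
    have h1 : IsOpen {p : (Fin d → ℝ) × (Fin d → ℝ) | ‖p.1‖ < R} :=
      isOpen_lt continuous_fst.norm continuous_const
    have h2 : IsOpen {p : (Fin d → ℝ) × (Fin d → ℝ) | ‖p.2‖ < R} :=
      isOpen_lt continuous_snd.norm continuous_const
    have h3 : IsOpen {p : (Fin d → ℝ) × (Fin d → ℝ) | p.1 ≠ p.2} :=
      isOpen_ne_fun continuous_fst continuous_snd
    exact h1.inter (h2.inter h3)
  have hmem : (x, y) ∈ closure
      (S ∩ Set.range (TopologicalSpace.denseSeq ((Fin d → ℝ) × (Fin d → ℝ)))) :=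
    (TopologicalSpace.denseRange_denseSeq _).open_subset_closure_inter hSo ⟨hx, hy, hxy⟩
  have hC : IsClosed {p : (Fin d → ℝ) × (Fin d → ℝ) |
      |φ p.1 - φ p.2| ≤ (lipConst R φ).toReal * ‖p.1 - p.2‖} :=
    isClosed_le (by fun_prop) (by fun_prop)
  refine closure_minimal ?_ hC hmem
  rintro p ⟨hp, n, rfl⟩
  have h1 := abs_slopeSeq_le h n
  have hp' : _ ∧ _ ∧ _ := hp
  rw [slopeSeq, if_pos hp', abs_div, abs_norm, div_le_iff₀ (norm_pos_iff.2 (sub_ne_zero.2 hp'.2.2))]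
    at h1
  exact h1

lemma lipConst_le {R L : ℝ} {φ : (Fin d → ℝ) → ℝ} (hL : 0 ≤ L)
    (h : ∀ x y, ‖x‖ < R → ‖y‖ < R → |φ x - φ y| ≤ L * ‖x - y‖) :
    lipConst R φ ≤ ENNReal.ofReal L := by
  refine iSup_le fun n => ?_
  rw [← ofReal_norm]
  refine ENNReal.ofReal_le_ofReal ?_
  rw [Real.norm_eq_abs, slopeSeq]
  split_ifs with hp
  · rw [abs_div, abs_norm, div_le_iff₀ (norm_pos_iff.2 (sub_ne_zero.2 hp.2.2))]
    exact h _ _ hp.1 hp.2.1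
  · simpa using hL

lemma lipConst_lt_top_of_contDiff {R : ℝ} {φ : (Fin d → ℝ) → ℝ} (h : ContDiff ℝ 2 φ) :
    lipConst R φ < ∞ := by
  obtain ⟨K, hK⟩ := (h.contDiffOn (s := Metric.closedBall 0 R)).exists_lipschitzOnWith
    (by simp) (convex_closedBall 0 R) (isCompact_closedBall 0 R)
  refine (lipConst_le (L := K) K.2 fun x y hx hy => ?_).trans_lt ENNReal.ofReal_lt_top
  have := hK.dist_le_mul x (by simpa using hx.le) y (by simpa using hy.le)
  simpa [dist_eq_norm] using this

lemma measurable_slopeSeq (R : ℝ) (n : ℕ) :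
    Measurable fun φ : (Fin d → ℝ) → ℝ => slopeSeq R φ n := by
  unfold slopeSeq
  dsimp only
  split_ifs
  · have h : ∀ x, Measurable fun φ : (Fin d → ℝ) → ℝ => φ x := fun x => measurable_pi_apply x
    exact ((h _).sub (h _)).div_const _
  · exact measurable_const

lemma measurable_lipConst (R : ℝ) :
    Measurable fun φ : (Fin d → ℝ) → ℝ => lipConst R φ :=
  Measurable.iSup fun n => (measurable_slopeSeq R n).enorm

lemma tendsto_norm_slopeSeq {R : ℝ} {φ : (Fin d → ℝ) → ℝ} (h : lipConst R φ ≠ ∞) :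
    Tendsto (fun N : ℕ => ‖fun i : Fin N => slopeSeq R φ i‖) atTop
      (𝓝 (lipConst R φ).toReal) := by
  refine tendsto_order.2 ⟨fun a ha => ?_, fun a ha => Eventually.of_forall fun N => ?_⟩
  · by_cases ha0 : a < 0
    · exact Eventually.of_forall fun N => ha0.trans_le (norm_nonneg _)
    have h1 : ENNReal.ofReal a < lipConst R φ :=
      (ENNReal.ofReal_lt_iff_lt_toReal (not_lt.1 ha0) h).2 ha
    obtain ⟨n, hn⟩ := lt_iSup_iff.1 h1
    rw [← ofReal_norm, ENNReal.ofReal_lt_ofReal_iff_of_nonneg (not_lt.1 ha0)] at hn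
    filter_upwards [eventually_gt_atTop n] with N hN
    exact hn.trans_le (norm_le_pi_norm (fun i : Fin N => slopeSeq R φ i) ⟨n, hN⟩)
  · refine lt_of_le_of_lt ?_ ha
    exact (pi_norm_le_iff_of_nonneg ENNReal.toReal_nonneg).2 fun i => abs_slopeSeq_le h i

end LipschitzModulus

section FieldLipschitz

open scoped ENNReal NNReal Topology

variable {Ω : Type} [MeasureSpace Ω] {d : ℕ}

namespace IsHomGaussField

variable {f : (Fin d → ℝ) → Ω → ℝ}

lemma ae_lipConst_lt_top (hf : IsHomGaussField f) (R : ℝ) (y : Fin d → ℝ) :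
    ∀ᵐ ω ∂(ℙ : Measure Ω), lipConst R (fun x => f (y + x) ω) < ∞ := by
  filter_upwards [hf.smooth] with ω hω
  refine lipConst_lt_top_of_contDiff ?_
  exact hω.comp (f := fun x => y + x) (by fun_prop)

lemma measurable_shift (hf : IsHomGaussField f) (y : Fin d → ℝ) :
    Measurable fun ω x => f (y + x) ω := measurable_pi_lambda _ fun _ => hf.meas _

lemma measurable_resid (hf : IsHomGaussField f) (y : Fin d → ℝ) :
    Measurable (resid f y) :=
  measurable_pi_lambda _ fun _ => (hf.meas _).sub ((hf.meas _).const_mul _)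

lemma map_shift_eq (hf : IsHomGaussField f) {ι : Type*} [Fintype ι] (t : ι → (Fin d → ℝ))
    (y : Fin d → ℝ) :
    Measure.map (fun ω i => f (y + t i) ω) (ℙ : Measure Ω) =
      Measure.map (fun ω i => f (0 + t i) ω) (ℙ : Measure Ω) := by
  have h := hf.stat (Fintype.card ι) (t ∘ (Fintype.equivFin ι).symm) y
  have key : ∀ z, Measure.map (fun ω i => f (z + t i) ω) (ℙ : Measure Ω) =
      (Measure.map (fun ω (i : Fin (Fintype.card ι)) => f (z + t ((Fintype.equivFin ι).symm i)) ω)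
        (ℙ : Measure Ω)).map (fun g i => g (Fintype.equivFin ι i)) := by
    intro z
    rw [Measure.map_map (by fun_prop) (measurable_pi_lambda _ fun i => hf.meas _)]
    congr 1
    ext ω i
    simp
  rw [key, key]
  congr 1
  simpa [add_comm] using h

/-- The endpoints and coefficients of the difference quotients as linear combinations. -/
lemma exists_slopeSeq_eq (R : ℝ) : ∃ (t : ℕ → Fin 2 → (Fin d → ℝ)) (c : ℕ → Fin 2 → ℝ),
    ∀ (φ : (Fin d → ℝ) → ℝ) n, slopeSeq R φ n = ∑ j, c n j * φ (t n j) := by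
  refine ⟨fun n => ![(TopologicalSpace.denseSeq ((Fin d → ℝ) × (Fin d → ℝ)) n).1,
    (TopologicalSpace.denseSeq ((Fin d → ℝ) × (Fin d → ℝ)) n).2], fun n =>
    let p := TopologicalSpace.denseSeq ((Fin d → ℝ) × (Fin d → ℝ)) n
    if ‖p.1‖ < R ∧ ‖p.2‖ < R ∧ p.1 ≠ p.2 then ![1 / ‖p.1 - p.2‖, - (1 / ‖p.1 - p.2‖)] else 0,
    fun φ n => ?_⟩
  dsimp only [slopeSeq]
  split_ifs
  · simp [Fin.sum_univ_two]; ring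
  · simp

lemma map_slopeSeq_shift (hf : IsHomGaussField f) (R : ℝ) (N : ℕ) (y : Fin d → ℝ) :
    Measure.map (fun ω (i : Fin N) => slopeSeq R (fun x => f (y + x) ω) i) (ℙ : Measure Ω) =
      Measure.map (fun ω (i : Fin N) => slopeSeq R (fun x => f (0 + x) ω) i) (ℙ : Measure Ω) := by
  obtain ⟨t, c, h⟩ := exists_slopeSeq_eq (d := d) R
  simp_rw [h]
  have key : ∀ z, Measure.map (fun ω (i : Fin N) => ∑ j, c i j * f (z + t i j) ω) (ℙ : Measure Ω)
      = (Measure.map (fun ω (p : Fin N × Fin 2) => f (z + t p.1 p.2) ω) (ℙ : Measure Ω)).map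
        (fun (g : Fin N × Fin 2 → ℝ) (i : Fin N) => ∑ j, c i j * g (i, j)) := by
    intro z
    rw [Measure.map_map (by fun_prop) (measurable_pi_lambda _ fun i => hf.meas _)]
    rfl
  rw [key, key, hf.map_shift_eq (fun p : Fin N × Fin 2 => t p.1 p.2) y]

lemma fernique_slopeSeq [IsProbabilityMeasure (ℙ : Measure Ω)] (hf : IsHomGaussField f) (R : ℝ) :
    ∃ α : ℝ, 0 < α ∧ ∃ K : ℝ≥0∞, K < ∞ ∧ ∀ (y : Fin d → ℝ) (N : ℕ),
      ∫⁻ ω, ENNReal.ofReal (Real.exp (α * ‖fun i : Fin N =>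
        slopeSeq R (fun x => f (y + x) ω) i‖ ^ 2)) ≤ K := by
  have mL : Measurable fun ω => lipConst R (fun x => f (0 + x) ω) :=
    (measurable_lipConst R).comp (hf.measurable_shift 0)
  -- a level `a` below which the Lipschitz constant stays with probability at least `3 / 4`
  obtain ⟨a, ha0, ha⟩ : ∃ a : ℝ, 0 < a ∧
      ENNReal.ofReal (3 / 4) ≤ ℙ {ω | lipConst R (fun x => f (0 + x) ω) ≤ ENNReal.ofReal a} := by
    have hmono : Monotone fun n : ℕ =>
        {ω | lipConst R (fun x => f (0 + x) ω) ≤ ENNReal.ofReal (n : ℝ)} := by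
      intro m n hmn ω hω
      exact le_trans hω (ENNReal.ofReal_le_ofReal (by exact_mod_cast hmn))
    have h1 := tendsto_measure_iUnion_atTop (μ := (ℙ : Measure Ω)) hmono
    have h2 : ℙ (⋃ n : ℕ, {ω | lipConst R (fun x => f (0 + x) ω) ≤ ENNReal.ofReal (n : ℝ)})
        = 1 := by
      rw [prob_compl_eq_zero_iff₀ ?_ |>.symm]
      · rw [← nonpos_iff_eq_zero, ← ae_iff.1 (hf.ae_lipConst_lt_top R 0)]
        refine measure_mono fun ω hω hlt => hω ?_
        obtain ⟨n, hn⟩ := exists_nat_ge (lipConst R (fun x => f (0 + x) ω)).toReal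
        refine Set.mem_iUnion.2 ⟨n, ?_⟩
        exact (ENNReal.le_ofReal_iff_toReal_le hlt.ne (Nat.cast_nonneg n)).2 hn
      · exact (MeasurableSet.iUnion fun n => measurableSet_le mL measurable_const).nullMeasurableSet
    rw [h2] at h1
    have h3 : ENNReal.ofReal (3 / 4) < 1 := by
      rw [ENNReal.ofReal_lt_one]; norm_num
    obtain ⟨n, hn, hn0⟩ := ((h1.eventually (lt_mem_nhds h3)).and (eventually_gt_atTop 0)).exists
    exact ⟨n, by exact_mod_cast hn0, hn.le⟩
  have hc2 : (2 : ℝ≥0∞)⁻¹ < ENNReal.ofReal (3 / 4) := by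
    rw [← ENNReal.ofReal_ofNat, ← ENNReal.ofReal_inv_of_pos (by norm_num)]
    exact (ENNReal.ofReal_lt_ofReal_iff (by norm_num)).2 (by norm_num)
  have hc1 : ENNReal.ofReal (3 / 4) < 1 := by
    rw [ENNReal.ofReal_lt_one]; norm_num
  refine ⟨Fernique.logRatio (ENNReal.ofReal (3 / 4)) * a⁻¹ ^ 2,
    mul_pos (Fernique.logRatio_pos hc2 hc1) (by positivity),
    ENNReal.ofReal (Real.exp (Fernique.logRatio (ENNReal.ofReal (3 / 4))))
        + ∑' n : ℕ, ENNReal.ofReal (Real.exp (-2⁻¹ * Real.log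
          (ENNReal.ofReal (3 / 4) / (1 - ENNReal.ofReal (3 / 4))).toReal * 2 ^ n)), ?_, ?_⟩
  · refine ENNReal.add_lt_top.2 ⟨ENNReal.ofReal_lt_top, ?_⟩
    refine Summable.tsum_ofReal_lt_top <|
      Real.summable_exp_nat_mul_of_ge ?_ (fun i => mod_cast (Nat.lt_pow_self (by simp)).le)
    refine mul_neg_of_neg_of_pos (by simp) (Real.log_pos ?_)
    rw [← ENNReal.ofReal_one, ← ENNReal.ofReal_sub _ (by norm_num),
      ← ENNReal.ofReal_div_of_pos (by norm_num), ENNReal.toReal_ofReal (by norm_num)]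
    norm_num
  intro y N
  set V : (Fin d → ℝ) → Ω → (Fin N → ℝ) :=
    fun y ω i => slopeSeq R (fun x => f (y + x) ω) i with hV
  have mV : ∀ y, Measurable (V y) := fun y => measurable_pi_lambda _ fun i =>
    (measurable_slopeSeq R i).comp (hf.measurable_shift y)
  have e1 : ∫⁻ ω, ENNReal.ofReal (Real.exp (Fernique.logRatio (ENNReal.ofReal (3 / 4)) * a⁻¹ ^ 2
        * ‖V y ω‖ ^ 2)) =
      ∫⁻ v, ENNReal.ofReal (Real.exp (Fernique.logRatio (ENNReal.ofReal (3 / 4)) * a⁻¹ ^ 2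
        * ‖v‖ ^ 2)) ∂((ℙ : Measure Ω).map (V 0)) := by
    rw [← hf.map_slopeSeq_shift R N y, lintegral_map (by fun_prop) (mV y)]
  change ∫⁻ ω, ENNReal.ofReal (Real.exp (Fernique.logRatio (ENNReal.ofReal (3 / 4)) * a⁻¹ ^ 2
        * ‖V y ω‖ ^ 2)) ≤ _
  rw [e1]
  obtain ⟨t, c, htc⟩ := exists_slopeSeq_eq (d := d) R
  have hVc : V 0 = fun ω (i : Fin N) => ∑ j, c i j * f (t i j) ω := by
    ext ω i
    simp only [hV, htc, zero_add]
  have hG : IsGaussian ((ℙ : Measure Ω).map (V 0)) := by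
    rw [hVc]
    exact (hf.hasGaussianLaw_pi (fun i : Fin N => t i) (fun i : Fin N => c i)).isGaussian_map
  have hm : ((ℙ : Measure Ω).map (V 0))[id] = 0 := by
    rw [integral_map (mV 0).aemeasurable (by fun_prop)]
    have hI_int : Integrable (V 0) (ℙ : Measure Ω) := by
      rw [hVc]
      exact (hf.hasGaussianLaw_pi (fun i : Fin N => t i) (fun i : Fin N => c i)).integrable
    ext i
    simp only [id]
    rw [eval_integral (fun i => (hI_int.eval i))]
    rw [hVc]
    exact hf.integral_comb_eq_zero _ _
  refine lintegral_exp_mul_sq_norm_le_of_map_rotation_eq_self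
    (IsGaussian.map_rotation_eq_self hm _) (ha.trans ?_) hc2
  rw [Measure.map_apply (mV 0) (measurableSet_le (by fun_prop) measurable_const)]
  refine measure_mono fun ω hω => ?_
  refine (pi_norm_le_iff_of_nonneg ha0.le).2 fun i => ?_
  have h1 : ‖slopeSeq R (fun x => f (0 + x) ω) i‖ₑ ≤ ENNReal.ofReal a :=
    (le_iSup (fun n => ‖slopeSeq R (fun x => f (0 + x) ω) n‖ₑ) (i : ℕ)).trans hω
  rw [← ofReal_norm] at h1
  exact (ENNReal.ofReal_le_ofReal_iff ha0.le).1 h1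

lemma exists_lintegral_exp_sq_lipConst_le [IsProbabilityMeasure (ℙ : Measure Ω)] (hf : IsHomGaussField f) (R : ℝ) :
    ∃ α : ℝ, 0 < α ∧ ∃ K : ℝ≥0∞, K < ∞ ∧ ∀ y : Fin d → ℝ,
      ∫⁻ ω, ENNReal.ofReal (Real.exp (α * (lipConst R (fun x => f (y + x) ω)).toReal ^ 2))
        ≤ K := by
  obtain ⟨α, hα, K, hK, h⟩ := hf.fernique_slopeSeq R
  refine ⟨α, hα, K, hK, fun y => ?_⟩
  have mV : ∀ N, Measurable fun ω (i : Fin N) => slopeSeq R (fun x => f (y + x) ω) i :=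
    fun N => measurable_pi_lambda _ fun i =>
      (measurable_slopeSeq R i).comp (hf.measurable_shift y)
  calc ∫⁻ ω, ENNReal.ofReal (Real.exp (α * (lipConst R (fun x => f (y + x) ω)).toReal ^ 2))
      ≤ ∫⁻ ω, liminf (fun N : ℕ => ENNReal.ofReal (Real.exp (α * ‖fun i : Fin N =>
        slopeSeq R (fun x => f (y + x) ω) i‖ ^ 2))) atTop := by
        refine lintegral_mono_ae ?_
        filter_upwards [hf.ae_lipConst_lt_top R y] with ω hω
        refine (Tendsto.liminf_eq ?_).ge
        have := tendsto_norm_slopeSeq hω.ne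
        exact (ENNReal.continuous_ofReal.tendsto _).comp ((Real.continuous_exp.tendsto _).comp
          ((this.pow 2).const_mul α))
    _ ≤ liminf (fun N : ℕ => ∫⁻ ω, ENNReal.ofReal (Real.exp (α * ‖fun i : Fin N =>
        slopeSeq R (fun x => f (y + x) ω) i‖ ^ 2))) atTop := by
        refine lintegral_liminf_le fun N => ?_
        have := (mV N).norm
        fun_prop
    _ ≤ K := by
        refine liminf_le_of_le (by isBoundedDefault) fun b hb => ?_
        obtain ⟨N, hN⟩ := hb.exists
        exact hN.trans (h y N)

lemma exists_lintegral_exp_lipConst_le [IsProbabilityMeasure (ℙ : Measure Ω)] (hf : IsHomGaussField f) (R a : ℝ) :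
    ∃ K : ℝ≥0∞, K < ∞ ∧ ∀ y : Fin d → ℝ,
      ∫⁻ ω, ENNReal.ofReal (Real.exp (a * (lipConst R (fun x => f (y + x) ω)).toReal)) ≤ K := by
  obtain ⟨α, hα, K, hK, h⟩ := hf.exists_lintegral_exp_sq_lipConst_le R
  refine ⟨ENNReal.ofReal (Real.exp (a ^ 2 / (4 * α))) * K,
    ENNReal.mul_lt_top ENNReal.ofReal_lt_top hK, fun y => ?_⟩
  refine le_trans ?_ (mul_le_mul_right (h y) _)
  rw [← lintegral_const_mul' _ _ ENNReal.ofReal_ne_top]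
  refine lintegral_mono fun ω => ?_
  rw [← ENNReal.ofReal_mul (Real.exp_nonneg _), ← Real.exp_add]
  refine ENNReal.ofReal_le_ofReal (Real.exp_le_exp.2 ?_)
  set L := (lipConst R (fun x => f (y + x) ω)).toReal
  have : 0 ≤ (a - 2 * α * L) ^ 2 / (4 * α) := by positivity
  have e : (a - 2 * α * L) ^ 2 / (4 * α) = a ^ 2 / (4 * α) + α * L ^ 2 - a * L := by
    field_simp; ring
  linarith

end IsHomGaussField

end FieldLipschitz

section Covariance

open scoped ENNReal NNReal Topology

variable {Ω : Type} [MeasureSpace Ω] {d : ℕ}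

namespace IsHomGaussField

variable {f : (Fin d → ℝ) → Ω → ℝ}

lemma integrable_sq_lipConst [IsProbabilityMeasure (ℙ : Measure Ω)] (hf : IsHomGaussField f)
    (R : ℝ) (y : Fin d → ℝ) :
    Integrable (fun ω => (lipConst R (fun x => f (y + x) ω)).toReal ^ 2) (ℙ : Measure Ω) := by
  obtain ⟨α, hα, K, hK, h⟩ := hf.exists_lintegral_exp_sq_lipConst_le R
  have mL : Measurable fun ω => (lipConst R (fun x => f (y + x) ω)).toReal :=
    ((measurable_lipConst R).comp (hf.measurable_shift y)).ennreal_toReal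
  have h1 : Integrable
      (fun ω => α⁻¹ * Real.exp (α * (lipConst R (fun x => f (y + x) ω)).toReal ^ 2))
      (ℙ : Measure Ω) := by
    refine Integrable.const_mul
      ⟨(Real.measurable_exp.comp ((mL.pow_const 2).const_mul α)).aestronglyMeasurable, ?_⟩ _
    refine (hasFiniteIntegral_iff_ofReal (Eventually.of_forall fun ω => Real.exp_nonneg _)).2 ?_
    exact (h y).trans_lt hK
  refine h1.mono' (mL.pow_const 2).aestronglyMeasurable (Eventually.of_forall fun ω => ?_)
  rw [Real.norm_of_nonneg (sq_nonneg _), ← div_eq_inv_mul, le_div_iff₀ hα, mul_comm]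
  exact (le_add_of_nonneg_right zero_le_one).trans (Real.add_one_le_exp _)

lemma exists_one_sub_cov_le [IsProbabilityMeasure (ℙ : Measure Ω)] (hf : IsHomGaussField f) :
    ∃ C : ℝ, 0 < C ∧ ∀ h : Fin d → ℝ, 1 - cov f h ≤ C * ‖h‖ ^ 2 := by
  refine ⟨(∫ ω, (lipConst 1 (fun x => f (0 + x) ω)).toReal ^ 2) + 2, ?_, fun h => ?_⟩
  · have : 0 ≤ ∫ ω, (lipConst 1 (fun x => f (0 + x) ω)).toReal ^ 2 :=
      integral_nonneg fun ω => sq_nonneg _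
    linarith
  set I := ∫ ω, (lipConst 1 (fun x => f (0 + x) ω)).toReal ^ 2 with hI
  have hI0 : 0 ≤ I := integral_nonneg fun ω => sq_nonneg _
  by_cases hh : ‖h‖ < 1
  · have h1 : ∫ ω, (f 0 ω - f h ω) ^ 2 ≤ ∫ ω, ‖h‖ ^ 2 *
        (lipConst 1 (fun x => f (0 + x) ω)).toReal ^ 2 := by
      refine integral_mono_of_nonneg (Eventually.of_forall fun ω => sq_nonneg _)
        ((hf.integrable_sq_lipConst 1 0).const_mul _) ?_
      filter_upwards [hf.ae_lipConst_lt_top 1 0, hf.smooth] with ω h1 h2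
      have h3 := abs_sub_le_lipConst (φ := fun x => f (0 + x) ω) (x := 0) (y := h)
        (h2.continuous.comp (by fun_prop)) h1.ne (by simp) hh
      simp only [zero_add, zero_sub, norm_neg] at h3
      have h4 := pow_le_pow_left₀ (abs_nonneg _) h3 2
      rw [sq_abs] at h4
      simp only [zero_add]
      linarith [mul_pow (lipConst 1 fun x => f x ω).toReal ‖h‖ 2]
    rw [hf.integral_sub_sq, integral_const_mul, sub_zero] at h1
    nlinarith [sq_nonneg ‖h‖]
  · have h2 := (abs_le.1 (hf.abs_cov_le_one h)).1
    have h3 : (1 : ℝ) ≤ ‖h‖ ^ 2 := one_le_pow₀ (not_lt.1 hh)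
    nlinarith

lemma sq_integral_mul_le (μ : Measure Ω) {A B : Ω → ℝ} (hA : MemLp A 2 μ) (hB : MemLp B 2 μ) :
    (∫ ω, A ω * B ω ∂μ) ^ 2 ≤ (∫ ω, A ω ^ 2 ∂μ) * ∫ ω, B ω ^ 2 ∂μ := by
  have h : ∀ s : ℝ, 0 ≤ (∫ ω, A ω ^ 2 ∂μ) * (s * s) + (2 * ∫ ω, A ω * B ω ∂μ) * s
      + ∫ ω, B ω ^ 2 ∂μ := by
    intro s
    have h0 : 0 ≤ ∫ ω, (s * A ω + B ω) ^ 2 ∂μ := integral_nonneg fun ω => sq_nonneg _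
    have e : ∀ ω, (s * A ω + B ω) ^ 2
        = s * s * A ω ^ 2 + 2 * s * (A ω * B ω) + B ω ^ 2 := fun ω => by ring
    simp_rw [e] at h0
    have i1 := hA.integrable_sq.const_mul (s * s)
    have i2 : Integrable (fun ω => 2 * s * (A ω * B ω)) μ := (hA.integrable_mul hB).const_mul _
    have i12 : Integrable (fun ω => s * s * A ω ^ 2 + 2 * s * (A ω * B ω)) μ := i1.add i2
    rw [integral_add i12 hB.integrable_sq, integral_add i1 i2, integral_const_mul,
      integral_const_mul] at h0
    linarith
  have := discrim_le_zero h
  rw [discrim] at this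
  nlinarith

lemma exists_cov_bounds [IsProbabilityMeasure (ℙ : Measure Ω)] (hf : IsHomGaussField f) :
    ∃ C : ℝ, 0 < C ∧ (∀ h : Fin d → ℝ, 1 - cov f h ≤ C * ‖h‖ ^ 2) ∧
      ∀ x x' : Fin d → ℝ, |cov f x - cov f x'| ≤ C * (‖x‖ + ‖x'‖) * ‖x - x'‖ := by
  obtain ⟨C, hC, h⟩ := hf.exists_one_sub_cov_le
  refine ⟨3 * C, by positivity, fun y => (h y).trans (by nlinarith [sq_nonneg ‖y‖]),
    fun x x' => ?_⟩
  have hA := (hf.memLp_two 0).sub (hf.memLp_two x')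
  have hB := (hf.memLp_two x).sub (hf.memLp_two x')
  have h1 := sq_integral_mul_le ℙ hA hB
  simp only [Pi.sub_apply, hf.integral_sub_sq] at h1
  have e : ∫ ω, (f 0 ω - f x' ω) * (f x ω - f x' ω) = cov f x - cov f x' - cov f (x' - x) + 1 := by
    have e : ∀ ω, (f 0 ω - f x' ω) * (f x ω - f x' ω)
        = f 0 ω * f x ω - f 0 ω * f x' ω - (f x ω * f x' ω - f x' ω * f x' ω) := fun ω => by ring
    simp_rw [e]
    have i1 := hf.integrable_mul 0 x
    have i2 := hf.integrable_mul 0 x'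
    have i3 := hf.integrable_mul x x'
    have i4 := hf.integrable_mul x' x'
    have i12 : Integrable (fun ω => f 0 ω * f x ω - f 0 ω * f x' ω) (ℙ : Measure Ω) := i1.sub i2
    have i34 : Integrable (fun ω => f x ω * f x' ω - f x' ω * f x' ω) (ℙ : Measure Ω) :=
      i3.sub i4
    rw [integral_sub i12 i34, integral_sub i1 i2, integral_sub i3 i4]
    simp only [hf.integral_mul_eq_cov, sub_self, hf.cov_zero, sub_zero]
    ring
  rw [e] at h1
  have h2 := h x'
  have h3 := h (x' - x)
  have h4 := hf.cov_le_one (x' - x)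
  have h5 := hf.cov_le_one x'
  rw [norm_sub_rev] at h3
  have h6 : |cov f x - cov f x' - cov f (x' - x) + 1| ≤ 2 * C * ‖x'‖ * ‖x - x'‖ := by
    refine abs_le_of_sq_le_sq ?_ (by positivity)
    refine h1.trans ?_
    have h7 : 2 - 2 * cov f (x' - 0) ≤ 2 * C * ‖x'‖ ^ 2 := by rw [sub_zero]; linarith
    have h8 : 2 - 2 * cov f (x' - x) ≤ 2 * C * ‖x - x'‖ ^ 2 := by linarith
    refine (mul_le_mul h7 h8 (by linarith) (by positivity)).trans (le_of_eq ?_)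
    ring
  have h9 : ‖x - x'‖ ≤ ‖x‖ + ‖x'‖ := norm_sub_le _ _
  have h10 : C * ‖x - x'‖ ^ 2 ≤ C * (‖x‖ + ‖x'‖) * ‖x - x'‖ := by
    rw [sq, mul_assoc]; gcongr
  have h11 : 2 * C * ‖x'‖ * ‖x - x'‖ ≤ 2 * C * (‖x‖ + ‖x'‖) * ‖x - x'‖ := by
    gcongr; linarith [norm_nonneg x]
  obtain ⟨h12, h13⟩ := abs_le.1 h6
  refine abs_le.2 ⟨?_, ?_⟩ <;> linarith

lemma continuous_cov [IsProbabilityMeasure (ℙ : Measure Ω)] (hf : IsHomGaussField f) :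
    Continuous (cov f) := by
  obtain ⟨C, hC, -, h⟩ := hf.exists_cov_bounds
  refine continuous_iff_continuousAt.2 fun x => ?_
  refine tendsto_iff_norm_sub_tendsto_zero.2 ?_
  refine squeeze_zero (fun _ => norm_nonneg _) (fun z => h z x) ?_
  have : Continuous fun z : Fin d → ℝ => C * (‖z‖ + ‖x‖) * ‖z - x‖ := by fun_prop
  simpa using this.tendsto x

lemma continuous_resid [IsProbabilityMeasure (ℙ : Measure Ω)] (hf : IsHomGaussField f)
    (y : Fin d → ℝ) : ∀ᵐ ω ∂(ℙ : Measure Ω), Continuous (resid f y ω) := by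
  filter_upwards [hf.smooth] with ω hω
  have h1 := hω.continuous
  have h2 := hf.continuous_cov
  unfold resid
  fun_prop

lemma exists_lipConst_resid_le [IsProbabilityMeasure (ℙ : Measure Ω)] (hf : IsHomGaussField f)
    {R : ℝ} (hR : 0 ≤ R) :
    ∃ C : ℝ, 0 ≤ C ∧ ∀ y, ∀ᵐ ω ∂(ℙ : Measure Ω), lipConst R (resid f y ω) ≤
      ENNReal.ofReal ((lipConst R (fun x => f (y + x) ω)).toReal + C * |f y ω|) := by
  obtain ⟨C, hC, -, h⟩ := hf.exists_cov_bounds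
  refine ⟨C * (R + R), by positivity, fun y => ?_⟩
  filter_upwards [hf.ae_lipConst_lt_top R y, hf.smooth] with ω h1 h2
  refine lipConst_le (by positivity) fun x x' hx hx' => ?_
  have h3 := abs_sub_le_lipConst (φ := fun x => f (y + x) ω) (x := x) (y := x')
    (h2.continuous.comp (by fun_prop)) h1.ne hx hx'
  have h4 := h x x'
  have e : resid f y ω x - resid f y ω x'
      = (f (y + x) ω - f (y + x') ω) - (cov f x - cov f x') * f y ω := by
    simp only [resid]; ring
  rw [e]
  refine (abs_sub _ _).trans ?_
  rw [abs_mul, add_mul]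
  refine add_le_add h3 ?_
  calc |cov f x - cov f x'| * |f y ω|
      ≤ (C * (R + R) * ‖x - x'‖) * |f y ω| := by
        refine mul_le_mul_of_nonneg_right (h4.trans ?_) (abs_nonneg _)
        gcongr
    _ = _ := by ring

lemma ae_lipConst_resid_lt_top [IsProbabilityMeasure (ℙ : Measure Ω)] (hf : IsHomGaussField f)
    {R : ℝ} (hR : 0 ≤ R) (y : Fin d → ℝ) :
    ∀ᵐ ω ∂(ℙ : Measure Ω), lipConst R (resid f y ω) < ∞ := by
  obtain ⟨C, -, h⟩ := hf.exists_lipConst_resid_le hR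
  filter_upwards [h y] with ω hω
  exact hω.trans_lt ENNReal.ofReal_lt_top

lemma lintegral_exp_abs_gaussianReal_lt_top (a : ℝ) :
    ∫⁻ z, ENNReal.ofReal (Real.exp (a * |z|)) ∂(gaussianReal 0 1) < ∞ := by
  have h : Integrable (fun z : ℝ => Real.exp (a * z) + Real.exp (-a * z)) (gaussianReal 0 1) :=
    (integrable_exp_mul_gaussianReal a).add (integrable_exp_mul_gaussianReal (-a))
  have h1 := h.lintegral_lt_top
  refine lt_of_le_of_lt (lintegral_mono fun z => ENNReal.ofReal_le_ofReal ?_) h1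
  rcases abs_cases z with ⟨h, -⟩ | ⟨h, -⟩ <;> rw [h]
  · linarith [Real.exp_pos (-a * z)]
  · rw [mul_neg, ← neg_mul]
    linarith [Real.exp_pos (a * z)]

lemma exists_lintegral_exp_lipConst_resid_le [IsProbabilityMeasure (ℙ : Measure Ω)]
    (hf : IsHomGaussField f) {R a : ℝ} (hR : 0 ≤ R) (ha : 0 ≤ a) :
    ∃ K : ℝ≥0∞, K < ∞ ∧ ∀ y : Fin d → ℝ,
      ∫⁻ ω, ENNReal.ofReal (Real.exp (a * (lipConst R (resid f y ω)).toReal)) ≤ K := by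
  obtain ⟨C, hC, hle⟩ := hf.exists_lipConst_resid_le hR
  obtain ⟨K, hK, h⟩ := hf.exists_lintegral_exp_lipConst_le R (2 * a)
  refine ⟨K + ∫⁻ z, ENNReal.ofReal (Real.exp (2 * a * C * |z|)) ∂(gaussianReal 0 1),
    ENNReal.add_lt_top.2 ⟨hK, lintegral_exp_abs_gaussianReal_lt_top _⟩, fun y => ?_⟩
  rw [← hf.map_eq_gaussianReal y, lintegral_map (by fun_prop) (hf.meas y)]
  refine le_trans ?_ (add_le_add_left (h y) _)
  have hm : Measurable fun ω => ENNReal.ofReal (Real.exp (2 * a * C * |f y ω|)) := by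
    have := hf.meas y
    have h2 := continuous_abs.measurable.comp this
    exact (Real.measurable_exp.comp (h2.const_mul _)).ennreal_ofReal
  rw [← lintegral_add_right _ hm]
  refine lintegral_mono_ae ?_
  filter_upwards [hle y] with ω hω
  rw [← ENNReal.ofReal_add (Real.exp_nonneg _) (Real.exp_nonneg _)]
  refine ENNReal.ofReal_le_ofReal ?_
  set L := (lipConst R (fun x => f (y + x) ω)).toReal with hL
  have hL0 : 0 ≤ L := ENNReal.toReal_nonneg
  have h1 : (lipConst R (resid f y ω)).toReal ≤ L + C * |f y ω| :=
    ENNReal.toReal_le_of_le_ofReal (by positivity) hω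
  rcases le_total L (C * |f y ω|) with h2 | h2
  · have : Real.exp (a * (lipConst R (resid f y ω)).toReal) ≤ Real.exp (2 * a * C * |f y ω|) :=
      Real.exp_le_exp.2 (by nlinarith)
    linarith [Real.exp_pos (2 * a * L)]
  · have : Real.exp (a * (lipConst R (resid f y ω)).toReal) ≤ Real.exp (2 * a * L) :=
      Real.exp_le_exp.2 (by nlinarith)
    linarith [Real.exp_pos (2 * a * C * |f y ω|)]

end IsHomGaussField

end Covariance

section GaussianTail

open scoped ENNReal NNReal Topology

lemma lintegral_exp_neg_abs_le {c : ℝ} (hc : 0 < c) (a : ℝ) :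
    ∫⁻ z in {z : ℝ | a < |z|}, ENNReal.ofReal (Real.exp (-c * |z|)) ≤
      ENNReal.ofReal (2 / c * Real.exp (-c * a)) := by
  have hsub : {z : ℝ | a < |z|} ⊆ Set.Ioi a ∪ Set.Iic (-a) := by
    intro z hz
    have hz' : a < |z| := hz
    rcases lt_abs.1 hz' with h | h
    · exact Or.inl h
    · exact Or.inr (by simp only [Set.mem_Iic]; linarith)
  refine (lintegral_mono_set hsub).trans ((lintegral_union_le _ _ _).trans ?_)
  have h1 : ∫⁻ z in Set.Ioi a, ENNReal.ofReal (Real.exp (-c * |z|)) ≤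
      ENNReal.ofReal (1 / c * Real.exp (-c * a)) := by
    have e : 1 / c * Real.exp (-c * a) = ∫ z in Set.Ioi a, Real.exp (-c * z) := by
      rw [integral_exp_mul_Ioi (by linarith)]; field_simp
    rw [e, ofReal_integral_eq_lintegral_ofReal (integrableOn_exp_mul_Ioi (by linarith) a)
      (Eventually.of_forall fun _ => Real.exp_nonneg _)]
    refine lintegral_mono fun z => ENNReal.ofReal_le_ofReal (Real.exp_le_exp.2 ?_)
    nlinarith [le_abs_self z]
  have h2 : ∫⁻ z in Set.Iic (-a), ENNReal.ofReal (Real.exp (-c * |z|)) ≤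
      ENNReal.ofReal (1 / c * Real.exp (-c * a)) := by
    have e : 1 / c * Real.exp (-c * a) = ∫ z in Set.Iic (-a), Real.exp (c * z) := by
      rw [integral_exp_mul_Iic hc]; ring_nf
    rw [e, ofReal_integral_eq_lintegral_ofReal (integrableOn_exp_mul_Iic hc (-a))
      (Eventually.of_forall fun _ => Real.exp_nonneg _)]
    refine lintegral_mono fun z => ENNReal.ofReal_le_ofReal (Real.exp_le_exp.2 ?_)
    nlinarith [neg_abs_le z]
  refine (add_le_add h1 h2).trans ?_
  rw [← ENNReal.ofReal_add (by positivity) (by positivity)]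
  refine ENNReal.ofReal_le_ofReal (le_of_eq ?_)
  ring

lemma gaussianPDFReal_le (b z : ℝ) :
    gaussianPDFReal 0 1 z ≤ Real.exp (b ^ 2 / 2 - b * |z|) := by
  have h1 : (√(2 * Real.pi))⁻¹ ≤ 1 :=
    inv_le_one_of_one_le₀ (Real.one_le_sqrt.2 (by linarith [Real.pi_gt_three]))
  have h2 : gaussianPDFReal 0 1 z = (√(2 * Real.pi))⁻¹ * Real.exp (-z ^ 2 / 2) := by
    simp [gaussianPDFReal]
  rw [h2, ← one_mul (Real.exp (b ^ 2 / 2 - b * |z|))]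
  refine mul_le_mul h1 (Real.exp_le_exp.2 ?_) (Real.exp_nonneg _) zero_le_one
  nlinarith [sq_nonneg (b - |z|), sq_abs z]

lemma setLIntegral_exp_gaussianReal_le {c : ℝ} (hc : 0 < c) (a b : ℝ) :
    ∫⁻ z in {z : ℝ | a < |z|}, ENNReal.ofReal (Real.exp ((b - c) * |z|)) ∂(gaussianReal 0 1) ≤
      ENNReal.ofReal (2 / c * Real.exp (b ^ 2 / 2 - c * a)) := by
  have hs : MeasurableSet {z : ℝ | a < |z|} :=
    measurableSet_lt measurable_const continuous_abs.measurable
  rw [gaussianReal_of_var_ne_zero 0 one_ne_zero,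
    setLIntegral_withDensity_eq_setLIntegral_mul _ (measurable_gaussianPDF 0 1) (by fun_prop) hs]
  calc ∫⁻ z in {z : ℝ | a < |z|},
        (gaussianPDF 0 1 * fun z => ENNReal.ofReal (Real.exp ((b - c) * |z|))) z
      ≤ ∫⁻ z in {z : ℝ | a < |z|}, ENNReal.ofReal (Real.exp (b ^ 2 / 2)) *
          ENNReal.ofReal (Real.exp (-c * |z|)) := by
        refine lintegral_mono fun z => ?_
        rw [Pi.mul_apply, gaussianPDF, ← ENNReal.ofReal_mul (gaussianPDFReal_nonneg _ _ _),
          ← ENNReal.ofReal_mul (Real.exp_nonneg _)]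
        refine ENNReal.ofReal_le_ofReal ?_
        refine (mul_le_mul_of_nonneg_right (gaussianPDFReal_le b z) (Real.exp_nonneg _)).trans ?_
        rw [← Real.exp_add, ← Real.exp_add]
        refine Real.exp_le_exp.2 (le_of_eq ?_)
        ring
    _ ≤ ENNReal.ofReal (Real.exp (b ^ 2 / 2)) *
          ENNReal.ofReal (2 / c * Real.exp (-c * a)) := by
        rw [lintegral_const_mul' _ _ ENNReal.ofReal_ne_top]
        gcongr
        exact lintegral_exp_neg_abs_le hc a
    _ = _ := by
        rw [← ENNReal.ofReal_mul (Real.exp_nonneg _)]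
        congr 1
        rw [sub_eq_add_neg, Real.exp_add, neg_mul]
        ring

lemma gaussianReal_Ioi_le {b : ℝ} (hb : 0 < b) (a : ℝ) :
    gaussianReal 0 1 (Set.Ioi a) ≤ ENNReal.ofReal (2 / b * Real.exp (b ^ 2 / 2 - b * a)) := by
  have h := setLIntegral_exp_gaussianReal_le hb a b
  simp only [sub_self, zero_mul, Real.exp_zero, ENNReal.ofReal_one, lintegral_const, one_mul,
    Measure.restrict_apply MeasurableSet.univ, Set.univ_inter] at h
  exact (measure_mono fun z hz => lt_of_lt_of_le hz (le_abs_self z)).trans h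

lemma le_gaussianReal_Ioi {b : ℝ} (hb : 1 ≤ b) :
    ENNReal.ofReal ((√(2 * Real.pi))⁻¹ * Real.exp (-(3 / 2)) * (1 / b * Real.exp (-b ^ 2 / 2))) ≤
      gaussianReal 0 1 (Set.Ioi b) := by
  have hb0 : 0 < b := by linarith
  rw [gaussianReal_apply 0 one_ne_zero]
  calc ENNReal.ofReal ((√(2 * Real.pi))⁻¹ * Real.exp (-(3 / 2)) * (1 / b * Real.exp (-b ^ 2 / 2)))
      = ∫⁻ z in Set.Ioc b (b + 1 / b),
          ENNReal.ofReal ((√(2 * Real.pi))⁻¹ * (Real.exp (-(3 / 2)) * Real.exp (-b ^ 2 / 2))) := by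
        rw [setLIntegral_const, Real.volume_Ioc, ← ENNReal.ofReal_mul (by positivity)]
        congr 1
        ring
    _ ≤ ∫⁻ z in Set.Ioc b (b + 1 / b), gaussianPDF 0 1 z := by
        refine setLIntegral_mono (measurable_gaussianPDF 0 1) fun z hz => ?_
        refine ENNReal.ofReal_le_ofReal ?_
        have h2 : gaussianPDFReal 0 1 z = (√(2 * Real.pi))⁻¹ * Real.exp (-z ^ 2 / 2) := by
          simp [gaussianPDFReal]
        rw [h2, ← Real.exp_add]
        refine mul_le_mul_of_nonneg_left (Real.exp_le_exp.2 ?_) (by positivity)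
        have h3 : z ^ 2 ≤ (b + 1 / b) ^ 2 := pow_le_pow_left₀ (by linarith [hz.1]) hz.2 2
        have h4 : (b + 1 / b) ^ 2 = b ^ 2 + 2 + (1 / b) ^ 2 := by field_simp; ring
        have h5 : (1 / b) ^ 2 ≤ 1 := pow_le_one₀ (by positivity) ((div_le_one hb0).2 hb)
        linarith
    _ ≤ _ := lintegral_mono_set fun z hz => hz.1

lemma gaussianReal_sqrt_Ioi_le {b v : ℝ} (hb : 0 < b) (hv0 : 0 ≤ v) (hv : v ≤ 4) :
    gaussianReal 0 v.toNNReal (Set.Ioi (2 * b)) ≤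
      ENNReal.ofReal (2 / b * Real.exp (-b ^ 2 / 2) * Real.exp (-(b ^ 2 * (4 - v) / 8))) := by
  rcases hv0.eq_or_lt with rfl | hv1
  · have : (gaussianReal 0 (0 : ℝ).toNNReal) (Set.Ioi (2 * b)) = 0 := by
      rw [Real.toNNReal_zero, gaussianReal_zero_var, Measure.dirac_apply' _ measurableSet_Ioi]
      simp [hb.le]
    rw [this]
    exact zero_le
  have hs : 0 < √v := Real.sqrt_pos.2 hv1
  have hs2 : √v ≤ 2 := Real.sqrt_le_iff.2 ⟨by norm_num, by linarith⟩
  have hvs : √v ^ 2 = v := Real.sq_sqrt hv0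
  have e : gaussianReal 0 v.toNNReal = (gaussianReal 0 1).map (fun x => √v * x) := by
    rw [gaussianReal_map_const_mul, mul_zero, mul_one]
    congr 1
    ext
    simp [hvs, hv0]
  have e2 : (fun x => √v * x) ⁻¹' (Set.Ioi (2 * b)) = Set.Ioi (2 * b / √v) := by
    ext x
    simp only [Set.mem_preimage, Set.mem_Ioi, div_lt_iff₀ hs, mul_comm]
  rw [e, Measure.map_apply (by fun_prop) measurableSet_Ioi, e2]
  have hb' : 0 < 2 * b / √v := by positivity
  refine (gaussianReal_Ioi_le hb' _).trans (ENNReal.ofReal_le_ofReal ?_)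
  rw [mul_assoc, ← Real.exp_add]
  have h1 : 2 / (2 * b / √v) ≤ 2 / b := by
    rw [div_div_eq_mul_div]
    rw [div_le_div_iff₀ (by positivity) hb]
    nlinarith
  refine mul_le_mul h1 (Real.exp_le_exp.2 ?_) (Real.exp_nonneg _) (by positivity)
  have h2 : (2 * b / √v) ^ 2 = 4 * b ^ 2 / v := by rw [div_pow, hvs]; ring
  have h3 : (2 * b / √v) ^ 2 / 2 - 2 * b / √v * (2 * b / √v) = - (2 * b ^ 2 / v) := by
    rw [← sq, h2]; ring
  rw [h3]
  have h4 : 2 * b ^ 2 / v - (b ^ 2 / 2 + b ^ 2 * (4 - v) / 8) = b ^ 2 * (4 - v) ^ 2 / (8 * v) := by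
    field_simp; ring
  have h5 : 0 ≤ b ^ 2 * (4 - v) ^ 2 / (8 * v) := by positivity
  linarith

end GaussianTail

section CellEstimate

open scoped ENNReal NNReal Topology

variable {Ω : Type} [MeasureSpace Ω] {d : ℕ}

namespace IsHomGaussField

variable {f : (Fin d → ℝ) → Ω → ℝ}

lemma measure_lt_eq (hf : IsHomGaussField f) (t : Fin d → ℝ) (a : ℝ) :
    ℙ {ω | a < f t ω} = gaussianReal 0 1 (Set.Ioi a) := by
  rw [← hf.map_eq_gaussianReal t, Measure.map_apply (hf.meas t) measurableSet_Ioi]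
  rfl

lemma measure_lt_and_lt_le (hf : IsHomGaussField f) (s t : Fin d → ℝ) {b : ℝ} (hb : 0 < b) :
    ℙ {ω | b < f s ω ∧ b < f t ω} ≤
      ENNReal.ofReal (2 / b * Real.exp (-b ^ 2 / 2) *
        Real.exp (-(b ^ 2 * (1 - cov f (t - s)) / 4))) := by
  have h0 := abs_le.1 (hf.abs_cov_le_one (t - s))
  have h := gaussianReal_sqrt_Ioi_le (b := b) (v := 2 + 2 * cov f (t - s)) hb (by linarith)
    (by linarith)
  have hm : Measurable fun ω => f s ω + f t ω := (hf.meas s).add (hf.meas t)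
  rw [← hf.map_add_eq_gaussianReal s t, Measure.map_apply hm measurableSet_Ioi] at h
  have e : b ^ 2 * (4 - (2 + 2 * cov f (t - s))) / 8 = b ^ 2 * (1 - cov f (t - s)) / 4 := by ring
  rw [e] at h
  refine le_trans (measure_mono fun ω hω => ?_) h
  simp only [Set.mem_preimage, Set.mem_Ioi]
  linarith [hω.1, hω.2]

lemma exists_cell_bound [IsProbabilityMeasure (ℙ : Measure Ω)] (hf : IsHomGaussField f)
    {R κ a : ℝ} (hR : 0 ≤ R) (hκ : 0 ≤ κ) (ha : 0 ≤ a) :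
    ∃ C : ℝ, 0 < C ∧ ∃ b₁ : ℝ, 1 ≤ b₁ ∧ ∀ b, b₁ < b → ∀ y : Fin d → ℝ,
      ∫⁻ ω in {ω | b - (lipConst R (resid f y ω)).toReal / b < |f y ω|},
        ENNReal.ofReal (Real.exp (κ / b * |f y ω| + a * (lipConst R (resid f y ω)).toReal)) ≤
      ENNReal.ofReal (C * (1 / b * Real.exp (-b ^ 2 / 2))) := by
  obtain ⟨K, hK, h⟩ := hf.exists_lintegral_exp_lipConst_resid_le hR (a := a + 1) (by linarith)
  refine ⟨4 * Real.exp κ * (K.toReal + 1), by positivity, 1 + 2 * κ, by linarith,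
    fun b hb y => ?_⟩
  have hb0 : 0 < b := by linarith
  set G : Ω → ℝ := fun ω => (lipConst R (resid f y ω)).toReal with hG
  have mG : Measurable G := ((measurable_lipConst R).comp (hf.measurable_resid y)).ennreal_toReal
  have hind : IndepFun (f y) G (ℙ : Measure Ω) :=
    (hf.indepFun_resid y).comp (φ := id) (ψ := fun φ => (lipConst R φ).toReal) measurable_id
      (measurable_lipConst R).ennreal_toReal
  have hprod := (indepFun_iff_map_prod_eq_prod_map_map (hf.meas y).aemeasurable
    mG.aemeasurable).1 hind
  set F : ℝ × ℝ → ℝ≥0∞ := {p : ℝ × ℝ | b - p.2 / b < |p.1|}.indicator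
    (fun p => ENNReal.ofReal (Real.exp (κ / b * |p.1| + a * p.2))) with hF
  have mS : MeasurableSet {p : ℝ × ℝ | b - p.2 / b < |p.1|} := by
    refine measurableSet_lt (by fun_prop) ?_
    exact continuous_abs.measurable.comp measurable_fst
  have mF : Measurable F := by
    refine Measurable.indicator ?_ mS
    have : Measurable fun p : ℝ × ℝ => |p.1| := continuous_abs.measurable.comp measurable_fst
    exact (Real.measurable_exp.comp ((this.const_mul _).add
      (measurable_snd.const_mul a))).ennreal_ofReal
  have mS' : MeasurableSet {ω | b - G ω / b < |f y ω|} :=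
    mS.preimage ((hf.meas y).prodMk mG)
  have e1 : ∫⁻ ω in {ω | b - G ω / b < |f y ω|},
      ENNReal.ofReal (Real.exp (κ / b * |f y ω| + a * G ω)) = ∫⁻ ω, F (f y ω, G ω) := by
    rw [← lintegral_indicator mS']
    rfl
  have e2 : ∫⁻ ω, F (f y ω, G ω) = ∫⁻ ω, ∫⁻ z, F (z, G ω) ∂(gaussianReal 0 1) := by
    rw [← lintegral_map (f := F) mF ((hf.meas y).prodMk mG), hprod,
      hf.map_eq_gaussianReal]
    have : IsProbabilityMeasure ((ℙ : Measure Ω).map G) :=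
      Measure.isProbabilityMeasure_map mG.aemeasurable
    rw [lintegral_prod_symm' _ mF, lintegral_map _ mG]
    exact mF.lintegral_prod_left'
  change ∫⁻ ω in {ω | b - G ω / b < |f y ω|},
      ENNReal.ofReal (Real.exp (κ / b * |f y ω| + a * G ω)) ≤ _
  rw [e1, e2]
  have key : ∀ g, 0 ≤ g → ∫⁻ z, F (z, g) ∂(gaussianReal 0 1) ≤
      ENNReal.ofReal (4 * Real.exp κ * (1 / b * Real.exp (-b ^ 2 / 2))) *
        ENNReal.ofReal (Real.exp ((a + 1) * g)) := by
    intro g hg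
    set c := b - κ / b with hc
    have hκb : κ / b ≤ b / 2 := by
      rw [div_le_iff₀ hb0]; nlinarith
    have hc0 : b / 2 ≤ c := by linarith
    have hs : MeasurableSet {z : ℝ | b - g / b < |z|} :=
      measurableSet_lt measurable_const continuous_abs.measurable
    have e3 : ∫⁻ z, F (z, g) ∂(gaussianReal 0 1) = ENNReal.ofReal (Real.exp (a * g)) *
        ∫⁻ z in {z : ℝ | b - g / b < |z|}, ENNReal.ofReal (Real.exp ((b - c) * |z|))
          ∂(gaussianReal 0 1) := by
      rw [← lintegral_const_mul' _ _ ENNReal.ofReal_ne_top, ← lintegral_indicator hs]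
      refine lintegral_congr fun z => ?_
      simp only [hF, Set.indicator]
      congr 1
      rw [← ENNReal.ofReal_mul (Real.exp_nonneg _), ← Real.exp_add]
      congr 2
      simp only [hc]; ring
    rw [e3]
    refine (mul_le_mul_right (setLIntegral_exp_gaussianReal_le (by linarith) _ b) _).trans ?_
    rw [← ENNReal.ofReal_mul (Real.exp_nonneg _), ← ENNReal.ofReal_mul (by positivity)]
    refine ENNReal.ofReal_le_ofReal ?_
    have h1 : 2 / c ≤ 4 / b := by
      rw [div_le_div_iff₀ (by linarith) hb0]; linarith
    have h2 : b ^ 2 / 2 - c * (b - g / b) ≤ κ + -b ^ 2 / 2 + g := by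
      have : c * (b - g / b) = b ^ 2 - κ - g + κ * g / b ^ 2 := by
        rw [hc]; field_simp; ring
      have h3 : 0 ≤ κ * g / b ^ 2 := by positivity
      linarith
    calc Real.exp (a * g) * (2 / c * Real.exp (b ^ 2 / 2 - c * (b - g / b)))
        ≤ Real.exp (a * g) * (4 / b * Real.exp (κ + -b ^ 2 / 2 + g)) := by
          gcongr
      _ = _ := by
          rw [Real.exp_add, Real.exp_add, add_mul, Real.exp_add, one_mul]; ring
  refine (lintegral_mono fun ω => key (G ω) ENNReal.toReal_nonneg).trans ?_
  rw [lintegral_const_mul' _ _ ENNReal.ofReal_ne_top]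
  refine (mul_le_mul_right (h y) _).trans ?_
  have hK2 : K ≤ ENNReal.ofReal (K.toReal + 1) := by
    rw [ENNReal.le_ofReal_iff_toReal_le hK.ne (by positivity)]; linarith
  refine (mul_le_mul_right hK2 _).trans ?_
  rw [← ENNReal.ofReal_mul (by positivity)]
  refine ENNReal.ofReal_le_ofReal (le_of_eq ?_)
  ring

end IsHomGaussField

end CellEstimate

section Counting

open scoped ENNReal NNReal Topology

variable {d : ℕ}

lemma norm_le_nrm (x : Fin d → ℝ) : ‖x‖ ≤ nrm x :=
  (pi_norm_le_iff_of_nonneg (Finset.sum_nonneg fun _ _ => abs_nonneg _)).2 fun i =>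
    Finset.single_le_sum (f := fun j => |x j|) (fun _ _ => abs_nonneg _) (Finset.mem_univ i)

lemma nrm_le_mul_norm (x : Fin d → ℝ) : nrm x ≤ d * ‖x‖ := by
  have h : nrm x ≤ ∑ _ : Fin d, ‖x‖ := Finset.sum_le_sum fun j _ => norm_le_pi_norm x j
  simpa using h

lemma nrm_add_le (x y : Fin d → ℝ) : nrm (x + y) ≤ nrm x + nrm y := by
  rw [nrm, nrm, nrm, ← Finset.sum_add_distrib]
  exact Finset.sum_le_sum fun _ _ => abs_add_le _ _

/-- The points of a net of mesh `2 ε / b` close to a point of the net cannot be too few. -/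
lemma one_div_card_near_le {T : Set (Fin d → ℝ)} {κ₀ : ℝ} (hκ₀ : 0 < κ₀)
    (hB2 : ∀ t ∈ T, ∀ ε : ℝ, 0 < ε → ε < 1 →
      κ₀ * ε ^ d ≤ (volume ({s | nrm (s - t) ≤ ε} ∩ T)).toReal)
    {b ε η : ℝ} (hb : 1 ≤ b) (hε : 0 < ε) (hη : 0 < η) (hη1 : η ≤ 1)
    {M : ℕ} {ts : Fin M → (Fin d → ℝ)} (hts : ∀ i, ts i ∈ T)
    (hcov : ∀ t ∈ T, ∃ i, nrm (ts i - t) ≤ 2 * (ε / b)) (k : Fin M) :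
    1 / ((Finset.univ.filter fun j : Fin M => nrm (ts j - ts k) ≤ η / b).card : ℝ) ≤
      (κ₀⁻¹ * 8 ^ d + 4 ^ d) * (ε / η) ^ d := by
  have hb0 : 0 < b := by linarith
  set J := Finset.univ.filter fun j : Fin M => nrm (ts j - ts k) ≤ η / b with hJ
  have hk : k ∈ J := by
    simp only [hJ, Finset.mem_filter, Finset.mem_univ, true_and, sub_self]
    have : nrm (0 : Fin d → ℝ) = 0 := by simp [nrm]
    rw [this]; positivity
  have hJ1 : (1 : ℝ) ≤ J.card := by exact_mod_cast Finset.card_pos.2 ⟨k, hk⟩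
  have hJ0 : (0 : ℝ) < J.card := by linarith
  by_cases h4 : 4 * ε ≤ η
  · have hsub : {s | nrm (s - ts k) ≤ η / (2 * b)} ∩ T ⊆
        ⋃ j ∈ J, Metric.closedBall (ts j) (2 * (ε / b)) := by
      rintro s ⟨hs, hsT⟩
      obtain ⟨i, hi⟩ := hcov s hsT
      refine Set.mem_iUnion₂.2 ⟨i, ?_, ?_⟩
      · simp only [hJ, Finset.mem_filter, Finset.mem_univ, true_and]
        have h1 := nrm_add_le (ts i - s) (s - ts k)
        rw [sub_add_sub_cancel] at h1
        have h2 : nrm (s - ts k) ≤ η / (2 * b) := hs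
        have h3 : 2 * (ε / b) ≤ η / (2 * b) := by
          rw [← mul_div_assoc, div_le_div_iff₀ hb0 (by positivity)]
          nlinarith
        have h5 : η / (2 * b) + η / (2 * b) = η / b := by field_simp; norm_num
        linarith
      · rw [Metric.mem_closedBall, dist_comm, dist_eq_norm]
        exact (norm_le_nrm _).trans hi
    have hr0 : 0 ≤ 2 * (ε / b) := by positivity
    have h1 : volume ({s | nrm (s - ts k) ≤ η / (2 * b)} ∩ T) ≤
        ENNReal.ofReal (J.card * (2 * (2 * (ε / b))) ^ d) := by
      refine (measure_mono hsub).trans ((measure_biUnion_finset_le _ _).trans ?_)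
      simp only [Real.volume_pi_closedBall _ hr0, Finset.sum_const, Fintype.card_fin,
        nsmul_eq_mul]
      rw [ENNReal.ofReal_mul (by positivity), ENNReal.ofReal_natCast]
    have hlt : η / (2 * b) < 1 := by rw [div_lt_one (by positivity)]; linarith
    have h2 := (hB2 _ (hts k) (η / (2 * b)) (by positivity) hlt).trans
      (ENNReal.toReal_le_of_le_ofReal (by positivity) h1)
    have h3 : κ₀ * η ^ d ≤ J.card * (8 * ε) ^ d := by
      have e1 : η / (2 * b) = η * (1 / (2 * b)) := by ring
      have e2 : 2 * (2 * (ε / b)) = (8 * ε) * (1 / (2 * b)) := by field_simp; norm_num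
      rw [e1, e2, mul_pow, mul_pow _ (1 / (2 * b)), ← mul_assoc, ← mul_assoc] at h2
      exact le_of_mul_le_mul_right h2 (by positivity)
    have h5 : 1 / (J.card : ℝ) ≤ κ₀⁻¹ * 8 ^ d * (ε / η) ^ d := by
      rw [div_le_iff₀ hJ0]
      have : κ₀⁻¹ * 8 ^ d * (ε / η) ^ d * J.card = (J.card * (8 * ε) ^ d) / (κ₀ * η ^ d) := by
        rw [div_pow, mul_pow]; field_simp
      rw [this, one_le_div (by positivity)]
      exact h3
    have h6 : 0 ≤ 4 ^ d * (ε / η) ^ d := by positivity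
    linarith
  · have h1 : 1 / (J.card : ℝ) ≤ 1 := by rw [div_le_one hJ0]; exact hJ1
    have h2 : (1 : ℝ) ≤ 4 ^ d * (ε / η) ^ d := by
      rw [← mul_pow]
      refine one_le_pow₀ ?_
      rw [← mul_div_assoc, one_le_div hη]
      linarith
    have h3 : 0 ≤ κ₀⁻¹ * 8 ^ d * (ε / η) ^ d := by positivity
    linarith

/-- If a path is well approximated by its value at `y`, and exceeds `b` near `y`, then it exceeds
`b - 1 / b` at many points of the net. -/
lemma one_div_card_exceed_le {T : Set (Fin d → ℝ)} {κ₀ : ℝ} (hκ₀ : 0 < κ₀)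
    (hB2 : ∀ t ∈ T, ∀ ε : ℝ, 0 < ε → ε < 1 →
      κ₀ * ε ^ d ≤ (volume ({s | nrm (s - t) ≤ ε} ∩ T)).toReal)
    {b ε : ℝ} (hb : 1 ≤ b) (hε : 0 < ε)
    {M : ℕ} {ts : Fin M → (Fin d → ℝ)} (hts : ∀ i, ts i ∈ T)
    (hcov : ∀ t ∈ T, ∃ i, nrm (ts i - t) ≤ 2 * (ε / b))
    {φ r : (Fin d → ℝ) → ℝ} {C G : ℝ} (hC : 0 ≤ C) (hG : 0 ≤ G) {y : Fin d → ℝ}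
    (hr0 : r 0 = 1) (hr1 : ∀ x, |r x| ≤ 1)
    (hr : ∀ x x', |r x - r x'| ≤ C * (‖x‖ + ‖x'‖) * ‖x - x'‖)
    (hφ : ∀ x x', ‖x‖ < 3 → ‖x'‖ < 3 →
      |(φ (y + x) - r x * φ y) - (φ (y + x') - r x' * φ y)| ≤ G * ‖x - x'‖)
    {k : Fin M} (hky : ‖ts k - y‖ ≤ 1 / b) (hk : φ (ts k) > b) :
    b - G / b < |φ y| ∧
    1 / ((Finset.univ.filter fun j : Fin M => φ (ts j) > b - 1 / b).card : ℝ) ≤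
      (κ₀⁻¹ * 8 ^ d + 4 ^ d) * ε ^ d * Real.exp (4 * d * C / b * |φ y| + d * G) := by
  have hb0 : 0 < b := by linarith
  have h1b : 1 / b ≤ 1 := (div_le_one hb0).2 hb
  set u := ts k - y with hu
  have hyu : y + u = ts k := by rw [hu]; abel
  refine ⟨?_, ?_⟩
  · have h1 := hφ u 0 (by linarith) (by simp)
    rw [hyu, hr0, add_zero, one_mul, sub_self, sub_zero, sub_zero] at h1
    have h2 := (abs_le.1 h1).2
    have h3 : r u * φ y ≤ |φ y| := by
      refine (le_abs_self _).trans ?_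
      rw [abs_mul]
      exact mul_le_of_le_one_left (abs_nonneg _) (hr1 u)
    have h4 : G * ‖u‖ ≤ G / b := by
      rw [div_eq_mul_one_div]; gcongr
    linarith
  set L := 4 * C / b * |φ y| + G with hL
  have hL0 : 0 ≤ L := by positivity
  have hlip : ∀ v, ‖v‖ ≤ 2 / b → |φ (y + u) - φ (y + v)| ≤ L * ‖u - v‖ := by
    intro v hv
    have h2b : 2 / b ≤ 2 := (div_le_iff₀ hb0).2 (by linarith)
    have h1 := hφ u v (by linarith) (by linarith)
    have h2 := hr u v
    have e : φ (y + u) - φ (y + v) = ((φ (y + u) - r u * φ y) - (φ (y + v) - r v * φ y))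
        + (r u - r v) * φ y := by ring
    rw [e]
    refine (abs_add_le _ _).trans ?_
    rw [abs_mul, hL, add_mul, add_comm]
    refine add_le_add ?_ h1
    have h3 : ‖u‖ + ‖v‖ ≤ 4 / b := by
      have : 4 / b = 1 / b + 2 / b + 1 / b := by ring
      have : 0 ≤ 1 / b := by positivity
      linarith
    calc |r u - r v| * |φ y| ≤ (C * (‖u‖ + ‖v‖) * ‖u - v‖) * |φ y| := by gcongr
      _ ≤ (C * (4 / b) * ‖u - v‖) * |φ y| := by gcongr
      _ = _ := by ring
  set η := 1 / (1 + L) with hη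
  have hη0 : 0 < η := by positivity
  have hη1 : η ≤ 1 := (div_le_one (by positivity)).2 (by linarith)
  have hJN : (Finset.univ.filter fun j : Fin M => nrm (ts j - ts k) ≤ η / b) ⊆
      Finset.univ.filter fun j : Fin M => φ (ts j) > b - 1 / b := by
    intro j hj
    simp only [Finset.mem_filter, Finset.mem_univ, true_and] at hj ⊢
    have h1 : ‖ts j - ts k‖ ≤ η / b := (norm_le_nrm _).trans hj
    have h2 : η / b ≤ 1 / b := by gcongr
    have h3 : ‖ts j - y‖ ≤ 2 / b := by
      have : ts j - y = (ts j - ts k) + u := by rw [hu]; abel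
      rw [this]
      refine (norm_add_le _ _).trans ?_
      have : 2 / b = 1 / b + 1 / b := by ring
      linarith
    have h4 := hlip _ h3
    have e1 : y + (ts j - y) = ts j := by abel
    have e2 : u - (ts j - y) = -(ts j - ts k) := by rw [hu]; abel
    rw [e1, e2, norm_neg, hyu] at h4
    have h5 : L * ‖ts j - ts k‖ ≤ 1 / b := by
      refine (mul_le_mul_of_nonneg_left h1 hL0).trans ?_
      rw [hη, ← mul_div_assoc, div_le_div_iff_of_pos_right hb0, mul_one_div,
        div_le_one (by positivity)]
      linarith
    have h6 := (abs_le.1 h4).2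
    linarith
  have hJ0 : (0 : ℝ) <
      ((Finset.univ.filter fun j : Fin M => nrm (ts j - ts k) ≤ η / b).card : ℝ) := by
    refine Nat.cast_pos.2 (Finset.card_pos.2 ⟨k, ?_⟩)
    simp only [Finset.mem_filter, Finset.mem_univ, true_and, sub_self]
    have : nrm (0 : Fin d → ℝ) = 0 := by simp [nrm]
    rw [this]; positivity
  refine (one_div_le_one_div_of_le hJ0 (by exact_mod_cast Finset.card_le_card hJN)).trans ?_
  refine (one_div_card_near_le hκ₀ hB2 hb hε hη0 hη1 hts hcov k).trans ?_
  have h1 : ε / η = ε * (1 + L) := by rw [hη, div_div_eq_mul_div, div_one]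
  rw [h1, mul_pow, ← mul_assoc]
  refine mul_le_mul_of_nonneg_left ?_ (by positivity)
  have h2 : 4 * d * C / b * |φ y| + d * G = d * L := by rw [hL]; ring
  rw [h2, Real.exp_nat_mul]
  gcongr
  linarith [Real.add_one_le_exp L]

/-- A bounded set is covered by `O(b ^ d)` cubes of radius `1 / b`. -/
lemma exists_grid_cover {T : Set (Fin d → ℝ)} (hT : Bornology.IsBounded T) :
    ∃ C : ℝ, 0 < C ∧ ∀ b : ℝ, 1 ≤ b → ∃ s : Finset (Fin d → ℝ),
      (s.card : ℝ) ≤ C * b ^ d ∧ ∀ t ∈ T, ∃ y ∈ s, ‖t - y‖ ≤ 1 / b := by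
  obtain ⟨R, hR0, hR⟩ := hT.exists_pos_norm_le
  refine ⟨(2 * R + 1) ^ d, by positivity, fun b hb => ?_⟩
  have hb0 : 0 < b := by linarith
  set m := ⌊2 * R * b⌋₊ + 1 with hm
  set y : (Fin d → Fin m) → (Fin d → ℝ) := fun k i => -R + (k i : ℝ) / b with hy
  refine ⟨Finset.univ.image y, ?_, fun t ht => ?_⟩
  · have h1 : (Finset.univ.image y).card ≤ m ^ d := by
      refine Finset.card_image_le.trans ?_
      simp
    have h2 : (m : ℝ) ≤ (2 * R + 1) * b := by
      have := Nat.floor_le (a := 2 * R * b) (by positivity)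
      rw [hm]; push_cast; linarith
    calc ((Finset.univ.image y).card : ℝ) ≤ (m : ℝ) ^ d := by exact_mod_cast h1
      _ ≤ ((2 * R + 1) * b) ^ d := by gcongr
      _ = _ := mul_pow _ _ _
  · have hti : ∀ i, |t i| ≤ R := fun i => (norm_le_pi_norm t i).trans (hR t ht)
    have hlt : ∀ i, ⌊(t i + R) * b⌋₊ < m := by
      intro i
      refine Nat.lt_succ_of_le (Nat.floor_le_floor ?_)
      have := (abs_le.1 (hti i)).2
      nlinarith
    refine ⟨y fun i => ⟨⌊(t i + R) * b⌋₊, hlt i⟩, Finset.mem_image_of_mem _ (Finset.mem_univ _), ?_⟩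
    refine (pi_norm_le_iff_of_nonneg (by positivity)).2 fun i => ?_
    have h0 : 0 ≤ (t i + R) * b := by
      have := (abs_le.1 (hti i)).1
      exact mul_nonneg (by linarith) hb0.le
    have h1 := Nat.floor_le h0
    have h2 := Nat.lt_floor_add_one ((t i + R) * b)
    simp only [hy, Pi.sub_apply, Real.norm_eq_abs]
    rw [le_div_iff₀ hb0, ← abs_of_pos hb0, ← abs_mul, abs_of_pos hb0, sub_mul, add_mul,
      div_mul_cancel₀ _ hb0.ne']
    rw [add_mul] at h1 h2
    refine abs_le.2 ⟨?_, ?_⟩ <;> rw [add_mul] <;> linarith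

end Counting

section ReciprocalCount

open scoped ENNReal NNReal Topology

variable {Ω : Type} [MeasureSpace Ω] {d : ℕ}

lemma setLIntegral_biUnion_finset_le {α ι : Type*} [MeasurableSpace α] (μ : Measure α)
    (s : Finset ι) (A : ι → Set α) (g : α → ℝ≥0∞) :
    ∫⁻ x in ⋃ i ∈ s, A i, g x ∂μ ≤ ∑ i ∈ s, ∫⁻ x in A i, g x ∂μ := by
  induction s using Finset.induction_on with
  | empty => simp
  | insert i s hi ih =>
    rw [Finset.set_biUnion_insert, Finset.sum_insert hi]
    exact (lintegral_union_le _ _ _).trans (by gcongr)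

namespace IsHomGaussField

variable {f : (Fin d → ℝ) → Ω → ℝ}

lemma exists_lintegral_one_div_card_le [IsProbabilityMeasure (ℙ : Measure Ω)]
    (hf : IsHomGaussField f) {T : Set (Fin d → ℝ)} (hT : Bornology.IsBounded T) {κ₀ : ℝ}
    (hκ₀ : 0 < κ₀)
    (hB2 : ∀ t ∈ T, ∀ ε : ℝ, 0 < ε → ε < 1 →
      κ₀ * ε ^ d ≤ (volume ({s | nrm (s - t) ≤ ε} ∩ T)).toReal) :
    ∃ C : ℝ, 0 < C ∧ ∃ b₁ : ℝ, 1 ≤ b₁ ∧ ∀ b, b₁ < b → ∀ ε, 0 < ε →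
      ∀ (M : ℕ) (ts : Fin M → (Fin d → ℝ)), (∀ i, ts i ∈ T) →
      (∀ t ∈ T, ∃ i, nrm (ts i - t) ≤ 2 * (ε / b)) →
      ∫⁻ ω in {ω | ∃ k, f (ts k) ω > b}, ENNReal.ofReal
        (1 / ((Finset.univ.filter fun j : Fin M => f (ts j) ω > b - 1 / b).card : ℝ)) ≤
      ENNReal.ofReal (C * (ε ^ d * b ^ d * (1 / b * Real.exp (-b ^ 2 / 2)))) := by
  obtain ⟨C₁, hC₁, -, hC⟩ := hf.exists_cov_bounds
  obtain ⟨C₂, hC₂, b₁, hb₁, hcell⟩ := hf.exists_cell_bound (R := 3) (κ := 4 * d * C₁) (a := d)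
    (by norm_num) (by positivity) (by positivity)
  obtain ⟨C₃, hC₃, hgrid⟩ := exists_grid_cover hT
  set A := κ₀⁻¹ * 8 ^ d + 4 ^ d with hA
  have hA0 : 0 < A := by positivity
  refine ⟨C₃ * A * C₂, by positivity, b₁, hb₁, fun b hb ε hε M ts hts hcov => ?_⟩
  have hb1 : 1 ≤ b := by linarith
  have hb0 : 0 < b := by linarith
  obtain ⟨s, hs, hsT⟩ := hgrid b hb1
  set N : Ω → ℝ≥0∞ := fun ω => ENNReal.ofReal
    (1 / ((Finset.univ.filter fun j : Fin M => f (ts j) ω > b - 1 / b).card : ℝ)) with hN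
  have hsub : {ω | ∃ k, f (ts k) ω > b} ⊆
      ⋃ y ∈ s, {ω | ∃ k, ‖ts k - y‖ ≤ 1 / b ∧ f (ts k) ω > b} := by
    rintro ω ⟨k, hk⟩
    obtain ⟨y, hy, hky⟩ := hsT _ (hts k)
    exact Set.mem_iUnion₂.2 ⟨y, hy, k, hky, hk⟩
  have hcell' : ∀ y, ∫⁻ ω in {ω | ∃ k, ‖ts k - y‖ ≤ 1 / b ∧ f (ts k) ω > b}, N ω ≤
      ENNReal.ofReal (A * ε ^ d) *
        ENNReal.ofReal (C₂ * (1 / b * Real.exp (-b ^ 2 / 2))) := by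
    intro y
    refine le_trans ?_ (mul_le_mul_right (hcell b hb y) _)
    rw [← lintegral_const_mul' _ _ ENNReal.ofReal_ne_top]
    have m1 : MeasurableSet {ω | ∃ k, ‖ts k - y‖ ≤ 1 / b ∧ f (ts k) ω > b} := by
      have e : {ω | ∃ k, ‖ts k - y‖ ≤ 1 / b ∧ f (ts k) ω > b} =
          ⋃ k ∈ {k | ‖ts k - y‖ ≤ 1 / b}, {ω | f (ts k) ω > b} := by
        ext ω; simp
      rw [e]
      exact MeasurableSet.biUnion (Set.to_countable _) fun k _ =>
        measurableSet_lt measurable_const (hf.meas _)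
    have mG : Measurable fun ω => (lipConst 3 (resid f y ω)).toReal :=
      ((measurable_lipConst 3).comp (hf.measurable_resid y)).ennreal_toReal
    have m2 : MeasurableSet {ω | b - (lipConst 3 (resid f y ω)).toReal / b < |f y ω|} :=
      measurableSet_lt ((mG.div_const b).const_sub b)
        (continuous_abs.measurable.comp (hf.meas y))
    rw [← lintegral_indicator m1, ← lintegral_indicator m2]
    refine lintegral_mono_ae ?_
    filter_upwards [hf.ae_lipConst_resid_lt_top (R := 3) (by norm_num) y,
      hf.continuous_resid y] with ω h1 h2
    by_cases hω : ω ∈ {ω | ∃ k, ‖ts k - y‖ ≤ 1 / b ∧ f (ts k) ω > b}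
    · obtain ⟨k, hky, hk⟩ := hω
      obtain ⟨h3, h4⟩ := one_div_card_exceed_le hκ₀ hB2 hb1 hε hts hcov (φ := fun t => f t ω)
        (r := cov f) hC₁.le (G := (lipConst 3 (resid f y ω)).toReal) ENNReal.toReal_nonneg (y := y)
        hf.cov_zero hf.abs_cov_le_one hC
        (fun x x' hx hx' => abs_sub_le_lipConst h2 h1.ne hx hx') hky hk
      rw [Set.indicator_of_mem (show ω ∈ {ω | b - (lipConst 3 (resid f y ω)).toReal / b < |f y ω|}
        from h3), Set.indicator_of_mem
        (show ω ∈ {ω | ∃ k, ‖ts k - y‖ ≤ 1 / b ∧ f (ts k) ω > b} from ⟨k, hky, hk⟩),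
        ← ENNReal.ofReal_mul (by positivity)]
      exact ENNReal.ofReal_le_ofReal h4
    · rw [Set.indicator_of_notMem hω]
      exact zero_le
  calc ∫⁻ ω in {ω | ∃ k, f (ts k) ω > b}, N ω
      ≤ ∫⁻ ω in ⋃ y ∈ s, {ω | ∃ k, ‖ts k - y‖ ≤ 1 / b ∧ f (ts k) ω > b}, N ω :=
        lintegral_mono_set hsub
    _ ≤ ∑ y ∈ s, ∫⁻ ω in {ω | ∃ k, ‖ts k - y‖ ≤ 1 / b ∧ f (ts k) ω > b}, N ω :=
        setLIntegral_biUnion_finset_le _ _ _ _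
    _ ≤ ∑ _y ∈ s, ENNReal.ofReal (A * ε ^ d) *
        ENNReal.ofReal (C₂ * (1 / b * Real.exp (-b ^ 2 / 2))) :=
        Finset.sum_le_sum fun y _ => hcell' y
    _ ≤ _ := by
        rw [Finset.sum_const, nsmul_eq_mul, ← ENNReal.ofReal_mul (by positivity),
          ← ENNReal.ofReal_natCast, ← ENNReal.ofReal_mul (by positivity)]
        refine ENNReal.ofReal_le_ofReal ?_
        calc (s.card : ℝ) * (A * ε ^ d * (C₂ * (1 / b * Real.exp (-b ^ 2 / 2))))
            ≤ (C₃ * b ^ d) * (A * ε ^ d * (C₂ * (1 / b * Real.exp (-b ^ 2 / 2)))) := by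
              gcongr
          _ = _ := by ring

end IsHomGaussField

end ReciprocalCount

section Packing

open scoped ENNReal NNReal Topology

variable {d : ℕ}

/-- A separated subset of a bounded set has `O((b / ε) ^ d)` elements. -/
lemma exists_card_le_of_separated (hd : 0 < d) {T : Set (Fin d → ℝ)}
    (hT : Bornology.IsBounded T) :
    ∃ C : ℝ, 0 < C ∧ ∀ b : ℝ, 1 ≤ b → ∀ ε : ℝ, 0 < ε → ε ≤ 1 →
      ∀ (M : ℕ) (ts : Fin M → (Fin d → ℝ)), (∀ i, ts i ∈ T) →
      (∀ i j : Fin M, i ≠ j → ε / b ≤ nrm (ts i - ts j)) → (M : ℝ) ≤ C * (b / ε) ^ d := by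
  obtain ⟨R, hR0, hR⟩ := hT.exists_pos_norm_le
  refine ⟨(2 * d * (R + 1)) ^ d, by positivity, fun b hb ε hε hε1 M ts hts hsep => ?_⟩
  have hb0 : 0 < b := by linarith
  have hd0 : (0 : ℝ) < d := by exact_mod_cast hd
  have hd1 : (1 : ℝ) ≤ d := by exact_mod_cast hd
  set ρ := ε / (2 * d * b) with hρ
  have hρ0 : 0 < ρ := by positivity
  have hρ1 : ρ ≤ 1 := by
    rw [hρ, div_le_one (by positivity)]
    nlinarith [mul_le_mul hd1 hb zero_le_one hd0.le]
  have hdisj : Pairwise (Function.onFun Disjoint fun i => Metric.ball (ts i) ρ) := by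
    intro i j hij
    refine Metric.ball_disjoint_ball ?_
    have h1 := (hsep i j hij).trans (nrm_le_mul_norm _)
    rw [dist_eq_norm]
    have h2 : ρ + ρ = ε / b / d := by rw [hρ]; field_simp; norm_num
    rw [h2, div_le_iff₀ hd0, mul_comm]
    exact h1
  have hsub : ⋃ i, Metric.ball (ts i) ρ ⊆ Metric.closedBall 0 (R + 1) := by
    refine Set.iUnion_subset fun i x hx => ?_
    rw [Metric.mem_ball, dist_eq_norm] at hx
    rw [mem_closedBall_zero_iff]
    have h1 := norm_add_le (x - ts i) (ts i)
    rw [sub_add_cancel] at h1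
    linarith [hR _ (hts i)]
  have h1 := measure_mono (μ := volume) hsub
  rw [measure_iUnion hdisj fun i => Metric.isOpen_ball.measurableSet, tsum_fintype,
    Real.volume_pi_closedBall _ (by positivity)] at h1
  simp only [Real.volume_pi_ball _ hρ0, Finset.sum_const, Finset.card_univ, Fintype.card_fin,
    nsmul_eq_mul] at h1
  rw [← ENNReal.ofReal_natCast, ← ENNReal.ofReal_mul (by positivity),
    ENNReal.ofReal_le_ofReal_iff (by positivity)] at h1
  have e1 : 2 * ρ = 1 / (d * (b / ε)) := by rw [hρ]; field_simp
  rw [e1, div_pow, one_pow, mul_one_div, div_le_iff₀ (by positivity), ← mul_pow] at h1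
  rw [← mul_pow]
  calc (M : ℝ) ≤ _ := h1
    _ = _ := by ring

end Packing

section Nondegeneracy

open scoped ENNReal NNReal Topology

variable {Ω : Type} [MeasureSpace Ω] {d : ℕ}

namespace IsHomGaussField

variable {f : (Fin d → ℝ) → Ω → ℝ}

/-- Almost surely, the paths are periodic with respect to every `h` with covariance `1`. -/
lemma ae_periodic [IsProbabilityMeasure (ℙ : Measure Ω)] (hf : IsHomGaussField f) :
    ∀ᵐ ω ∂(ℙ : Measure Ω), ∀ h, cov f h = 1 → ∀ s, f (s + h) ω = f s ω := by
  have : Nonempty {h | cov f h = 1} := ⟨⟨0, hf.cov_zero⟩⟩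
  have key : ∀ᵐ ω ∂(ℙ : Measure Ω), ∀ p : ℕ × ℕ,
      f (TopologicalSpace.denseSeq (Fin d → ℝ) p.1 +
        (TopologicalSpace.denseSeq {h | cov f h = 1} p.2 : Fin d → ℝ)) ω =
      f (TopologicalSpace.denseSeq (Fin d → ℝ) p.1) ω := by
    refine ae_all_iff.2 fun p => ?_
    set s := TopologicalSpace.denseSeq (Fin d → ℝ) p.1
    set h := TopologicalSpace.denseSeq {h | cov f h = 1} p.2
    have hh : cov f (h : Fin d → ℝ) = 1 := h.2
    have h0 := hf.integral_sub_sq s (s + h)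
    have hi : Integrable (fun ω => (f s ω - f (s + (h : Fin d → ℝ)) ω) ^ 2) ℙ :=
      ((hf.memLp_two s).sub (hf.memLp_two (s + h))).integrable_sq
    rw [add_sub_cancel_left, hh, mul_one, sub_self,
      integral_eq_zero_iff_of_nonneg (fun ω => sq_nonneg _) hi] at h0
    filter_upwards [h0] with ω hω
    have := pow_eq_zero_iff (two_ne_zero) |>.1 hω
    linarith
  filter_upwards [key, hf.smooth] with ω h1 h2 h hh s
  have hc := h2.continuous
  have hdr : DenseRange (Prod.map (TopologicalSpace.denseSeq (Fin d → ℝ))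
      (TopologicalSpace.denseSeq {h | cov f h = 1})) :=
    (TopologicalSpace.denseRange_denseSeq _).prodMap (TopologicalSpace.denseRange_denseSeq _)
  have h3 := hdr.equalizer
    (g := fun p : (Fin d → ℝ) × {h | cov f h = 1} => f (p.1 + (p.2 : Fin d → ℝ)) ω)
    (h := fun p : (Fin d → ℝ) × {h | cov f h = 1} => f p.1 ω)
    (hc.comp (continuous_fst.add (continuous_subtype_val.comp continuous_snd)))
    (hc.comp continuous_fst) (funext fun p => h1 p)
  exact congrFun h3 (s, ⟨h, hh⟩)

lemma measure_lt_and_lipConst_pos [IsProbabilityMeasure (ℙ : Measure Ω)]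
    (hf : IsHomGaussField f) (R : ℝ) (y : Fin d → ℝ) :
    ∃ g : ℝ, 0 ≤ g ∧ ∀ l : ℝ,
      0 < ℙ {ω | l < f y ω ∧ (lipConst R (resid f y ω)).toReal ≤ g} := by
  set G : Ω → ℝ := fun ω => (lipConst R (resid f y ω)).toReal with hG
  obtain ⟨n, hn⟩ : ∃ n : ℕ, 0 < ℙ {ω | G ω ≤ n} := by
    by_contra! hcon
    have h1 : ℙ (⋃ n : ℕ, {ω | G ω ≤ n}) = 0 :=
      measure_iUnion_null fun n => nonpos_iff_eq_zero.1 (hcon n)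
    have h2 : ⋃ n : ℕ, {ω | G ω ≤ n} = Set.univ :=
      Set.eq_univ_of_forall fun ω => Set.mem_iUnion.2 (exists_nat_ge (G ω))
    rw [h2, measure_univ] at h1
    exact one_ne_zero h1
  refine ⟨n, Nat.cast_nonneg n, fun l => ?_⟩
  have hind : IndepFun (f y) G (ℙ : Measure Ω) :=
    (hf.indepFun_resid y).comp (φ := id) (ψ := fun φ => (lipConst R φ).toReal) measurable_id
      (measurable_lipConst R).ennreal_toReal
  have h1 := hind.measure_inter_preimage_eq_mul (Set.Ioi l) (Set.Iic (n : ℝ))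
    measurableSet_Ioi measurableSet_Iic
  have h2 : 0 < ℙ (f y ⁻¹' Set.Ioi l) := by
    have h3 : ℙ {ω | l < f y ω} = _ := hf.measure_lt_eq y l
    refine lt_of_lt_of_le ?_ (h3.ge)
    refine lt_of_lt_of_le ?_ (measure_mono (Set.Ioi_subset_Ioi (le_max_left l 1)))
    refine lt_of_lt_of_le ?_ (le_gaussianReal_Ioi (le_max_right l 1))
    have : 0 < max l 1 := lt_max_of_lt_right one_pos
    exact ENNReal.ofReal_pos.2 (by positivity)
  have h4 : 0 < ℙ (f y ⁻¹' Set.Ioi l ∩ G ⁻¹' Set.Iic (n : ℝ)) := by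
    rw [h1]
    exact ENNReal.mul_pos h2.ne' hn.ne'
  exact h4

lemma exists_cov_lt_one [IsProbabilityMeasure (ℙ : Measure Ω)] (hf : IsHomGaussField f)
    {T : Set (Fin d → ℝ)} (hT : Bornology.IsBounded T) (hTint : (interior T).Nonempty)
    (huniq : ∀ᵐ ω ∂(ℙ : Measure Ω), ∃! t, t ∈ T ∧ ∀ s ∈ T, f s ω ≤ f t ω) :
    ∃ ρ : ℝ, 0 < ρ ∧ ∀ h, h ≠ 0 → ‖h‖ < ρ → cov f h < 1 := by
  by_contra! hcon
  obtain ⟨w, hw⟩ := hTint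
  obtain ⟨ρ, hρ, hball⟩ := Metric.isOpen_iff.1 isOpen_interior w hw
  obtain ⟨h', hh0, hh1, hh2⟩ := hcon (ρ / 2) (by positivity)
  have hh2 : cov f h' = 1 := le_antisymm (hf.cov_le_one _) hh2
  obtain ⟨R₀, hR₀, hR₁⟩ := hT.exists_pos_norm_le
  set R := R₀ + ‖w‖ + 1 with hR
  have hR0 : 0 < R := by positivity
  have hTR : ∀ t ∈ T, ‖t - w‖ < R := fun t ht => by
    have := norm_sub_le t w
    linarith [hR₁ t ht]
  have hcont : Continuous fun t => 1 - cov f t := continuous_const.sub hf.continuous_cov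
  obtain ⟨a, ha, haK⟩ : ∃ a, 0 < a ∧ ∀ t ∈ Metric.closedBall (0 : Fin d → ℝ) R ∩
      {t | ∀ h, cov f h = 1 → ρ / 2 ≤ ‖t - h‖}, a ≤ 1 - cov f t := by
    have hcl : IsClosed {t : Fin d → ℝ | ∀ h, cov f h = 1 → ρ / 2 ≤ ‖t - h‖} := by
      have e : {t : Fin d → ℝ | ∀ h, cov f h = 1 → ρ / 2 ≤ ‖t - h‖} =
          ⋂ h, ⋂ (_ : cov f h = 1), {t : Fin d → ℝ | ρ / 2 ≤ ‖t - h‖} := by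
        ext t; simp
      rw [e]
      exact isClosed_iInter fun h => isClosed_iInter fun _ =>
        isClosed_le continuous_const (continuous_id.sub continuous_const).norm
    refine ((isCompact_closedBall _ _).inter_right hcl).exists_forall_le'
      hcont.continuousOn fun t ht => ?_
    have h1 : cov f t ≠ 1 := fun h1 => by
      have := ht.2 t h1
      rw [sub_self, norm_zero] at this
      linarith
    have := lt_of_le_of_ne (hf.cov_le_one t) h1
    linarith
  obtain ⟨g, hg, hpos⟩ := hf.measure_lt_and_lipConst_pos R w
  have hgood : ∀ᵐ ω ∂(ℙ : Measure Ω), (∃! t, t ∈ T ∧ ∀ s ∈ T, f s ω ≤ f t ω) ∧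
      lipConst R (resid f w ω) < ∞ ∧ Continuous (resid f w ω) ∧
      ∀ h, cov f h = 1 → ∀ s, f (s + h) ω = f s ω := by
    filter_upwards [huniq, hf.ae_lipConst_resid_lt_top hR0.le w, hf.continuous_resid w,
      hf.ae_periodic] with ω h1 h2 h3 h4 using ⟨h1, h2, h3, h4⟩
  obtain ⟨ω, ⟨hω1, hω2⟩, ⟨t, ⟨htT, htmax⟩, htu⟩, hL, hc, hper⟩ :=
    ((frequently_ae_mem_iff.2 (hpos (g * R / a)).ne').and_eventually hgood).exists
  have hwT : w ∈ T := interior_subset hw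
  have htR := hTR t htT
  have h1 := abs_sub_le_lipConst hc hL.ne (x := t - w) (y := 0) htR (by simpa using hR0)
  have h2 : resid f w ω 0 = 0 := by simp [resid, hf.cov_zero]
  have h3 : resid f w ω (t - w) = f t ω - cov f (t - w) * f w ω := by
    simp [resid]
  rw [h2, h3, sub_zero, sub_zero] at h1
  have h4 : (lipConst R (resid f w ω)).toReal * ‖t - w‖ ≤ g * R := by gcongr
  have h5 := (abs_le.1 h1).2
  have h6 := htmax w hwT
  have h7 : g * R < f w ω * a := (div_lt_iff₀ ha).1 hω1
  have hw0 : 0 < f w ω := lt_of_le_of_lt (by positivity) hω1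
  have h8 : 1 - cov f (t - w) < a := by
    by_contra! h9
    have : a * f w ω ≤ (1 - cov f (t - w)) * f w ω := by gcongr
    linarith
  obtain ⟨h, hh, hhρ⟩ : ∃ h, cov f h = 1 ∧ ‖t - w - h‖ < ρ / 2 := by
    by_contra! h9
    have := haK (t - w) ⟨by simpa using htR.le, h9⟩
    linarith
  have hmem1 : t - h ∈ T := by
    refine interior_subset (hball ?_)
    rw [Metric.mem_ball, dist_eq_norm, sub_right_comm]
    linarith
  have hmem2 : t - h + h' ∈ T := by
    refine interior_subset (hball ?_)
    rw [Metric.mem_ball, dist_eq_norm]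
    have e : t - h + h' - w = (t - w - h) + h' := by abel
    rw [e]
    exact (norm_add_le _ _).trans_lt (by linarith)
  have e1 : f (t - h) ω = f t ω := by
    have := hper h hh (t - h)
    rw [sub_add_cancel] at this
    exact this.symm
  have e2 : f (t - h + h') ω = f t ω := (hper h' hh2 (t - h)).trans e1
  have u1 := htu (t - h) ⟨hmem1, fun s hs => e1 ▸ htmax s hs⟩
  have u2 := htu (t - h + h') ⟨hmem2, fun s hs => e2 ▸ htmax s hs⟩
  refine hh0 ?_
  rw [u1] at u2
  simpa using u2

lemma one_sub_cov_nsmul_le (hf : IsHomGaussField f) (k : ℕ) (t : Fin d → ℝ) :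
    1 - cov f ((k : ℝ) • t) ≤ (k : ℝ) ^ 2 * (1 - cov f t) := by
  have h1 : ∫ ω, (f 0 ω - f ((k : ℝ) • t) ω) ^ 2 ≤ ∫ ω, (k : ℝ) * ∑ i ∈ Finset.range k,
      (f ((i : ℝ) • t) ω - f (((i + 1 : ℕ) : ℝ) • t) ω) ^ 2 := by
    refine integral_mono_of_nonneg (Eventually.of_forall fun ω => sq_nonneg _) ?_
      (Eventually.of_forall fun ω => ?_)
    · exact (integrable_finsetSum _ fun i _ =>
        ((hf.memLp_two _).sub (hf.memLp_two _)).integrable_sq).const_mul _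
    · have h2 := Finset.sum_range_sub' (fun i : ℕ => f ((i : ℝ) • t) ω) k
      have h3 := sq_sum_le_card_mul_sum_sq (s := Finset.range k)
        (f := fun i : ℕ => f ((i : ℝ) • t) ω - f (((i + 1 : ℕ) : ℝ) • t) ω)
      rw [h2, Finset.card_range, Nat.cast_zero, zero_smul] at h3
      exact h3
  have hi : ∀ i ∈ Finset.range k,
      Integrable (fun ω => (f ((i : ℝ) • t) ω - f (((i + 1 : ℕ) : ℝ) • t) ω) ^ 2) ℙ :=
    fun i _ => ((hf.memLp_two _).sub (hf.memLp_two _)).integrable_sq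
  rw [integral_const_mul, integral_finsetSum _ hi, hf.integral_sub_sq, sub_zero] at h1
  have e : ∀ i : ℕ, ((i + 1 : ℕ) : ℝ) • t - (i : ℝ) • t = t := fun i => by
    rw [← sub_smul]; simp
  simp only [hf.integral_sub_sq, e, Finset.sum_const, Finset.card_range, nsmul_eq_mul] at h1
  linarith

lemma exists_le_one_sub_cov [IsProbabilityMeasure (ℙ : Measure Ω)] (hf : IsHomGaussField f)
    {ρ : ℝ} (hρ : 0 < ρ) (h : ∀ h, h ≠ 0 → ‖h‖ < ρ → cov f h < 1) :
    ∃ c : ℝ, 0 < c ∧ ∀ t : Fin d → ℝ, ‖t‖ ≤ ρ / 4 → c * ‖t‖ ^ 2 ≤ 1 - cov f t := by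
  have hcont : Continuous fun t => 1 - cov f t := continuous_const.sub hf.continuous_cov
  obtain ⟨a, ha, haK⟩ : ∃ a, 0 < a ∧ ∀ t ∈ Metric.closedBall (0 : Fin d → ℝ) (3 * ρ / 4) ∩
      {t | ρ / 2 ≤ ‖t‖}, a ≤ 1 - cov f t := by
    refine ((isCompact_closedBall _ _).inter_right
      (isClosed_le continuous_const continuous_norm)).exists_forall_le'
      hcont.continuousOn fun t ht => ?_
    have h1 : ‖t‖ ≤ 3 * ρ / 4 := by simpa using ht.1
    have h2 : ρ / 2 ≤ ‖t‖ := ht.2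
    have := h t (norm_pos_iff.1 (by linarith)) (by linarith)
    linarith
  refine ⟨a / ρ ^ 2, by positivity, fun t ht => ?_⟩
  rcases eq_or_ne t 0 with rfl | ht0
  · simp [hf.cov_zero]
  have htn : 0 < ‖t‖ := norm_pos_iff.2 ht0
  set k := ⌈ρ / (2 * ‖t‖)⌉₊ with hk
  have hk1 : ρ / (2 * ‖t‖) ≤ k := Nat.le_ceil _
  have hk2 : (k : ℝ) < ρ / (2 * ‖t‖) + 1 := Nat.ceil_lt_add_one (by positivity)
  have e : ρ / (2 * ‖t‖) * ‖t‖ = ρ / 2 := by field_simp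
  have h1 : ρ / 2 ≤ k * ‖t‖ := by rw [← e]; gcongr
  have h2 : k * ‖t‖ ≤ 3 * ρ / 4 := by
    have : k * ‖t‖ ≤ (ρ / (2 * ‖t‖) + 1) * ‖t‖ := by gcongr
    rw [add_mul, e] at this
    linarith
  have hn : ‖(k : ℝ) • t‖ = k * ‖t‖ := by rw [norm_smul]; simp
  have h3 := (haK ((k : ℝ) • t) ⟨by simpa [hn] using h2, by
    change ρ / 2 ≤ ‖(k : ℝ) • t‖
    rw [hn]; exact h1⟩).trans (hf.one_sub_cov_nsmul_le k t)
  have h0 : 0 ≤ 1 - cov f t := by linarith [hf.cov_le_one t]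
  have h4 : (k * ‖t‖) ^ 2 ≤ ρ ^ 2 := pow_le_pow_left₀ (by positivity) (by linarith) 2
  rw [div_mul_eq_mul_div, div_le_iff₀ (by positivity)]
  calc a * ‖t‖ ^ 2 ≤ ((k : ℝ) ^ 2 * (1 - cov f t)) * ‖t‖ ^ 2 := by gcongr
    _ = (1 - cov f t) * (k * ‖t‖) ^ 2 := by ring
    _ ≤ _ := by gcongr

end IsHomGaussField

end Nondegeneracy

section LowerBound

open scoped ENNReal NNReal Topology

/-- A second moment lower bound for the probability of a union. -/
lemma div_le_measure_iUnion_of_sum_inter_le {Ω ι : Type*} [MeasurableSpace Ω] [Fintype ι]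
    (μ : Measure Ω) [IsProbabilityMeasure μ] {A : ι → Set Ω} (hA : ∀ k, MeasurableSet (A k))
    {D : ℝ} (hD : 0 < D)
    (h : ∑ k, ∑ l, μ.real (A k ∩ A l) ≤ D * ∑ k, μ.real (A k)) :
    (∑ k, μ.real (A k)) / D ≤ μ.real (⋃ k, A k) := by
  have hi : ∀ s : Set Ω, MeasurableSet s → Integrable (s.indicator (1 : Ω → ℝ)) μ := fun s hs =>
    (integrable_const (1 : ℝ)).indicator hs
  have hi1 : Integrable (fun ω => ∑ k, (A k).indicator (1 : Ω → ℝ) ω) μ :=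
    integrable_finsetSum _ fun k _ => hi _ (hA k)
  have hi2 : Integrable (fun ω => ∑ k, ∑ l, (A k ∩ A l).indicator (1 : Ω → ℝ) ω) μ :=
    integrable_finsetSum _ fun k _ => integrable_finsetSum _ fun l _ => hi _ ((hA k).inter (hA l))
  have e1 : ∫ ω, ∑ k, (A k).indicator (1 : Ω → ℝ) ω ∂μ = ∑ k, μ.real (A k) := by
    rw [integral_finsetSum _ fun k _ => hi _ (hA k)]
    exact Finset.sum_congr rfl fun k _ => integral_indicator_one (hA k)
  have e2 : ∫ ω, ∑ k, ∑ l, (A k ∩ A l).indicator (1 : Ω → ℝ) ω ∂μ =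
      ∑ k, ∑ l, μ.real (A k ∩ A l) := by
    rw [integral_finsetSum _ fun k _ => integrable_finsetSum _ fun l _ =>
      hi _ ((hA k).inter (hA l))]
    refine Finset.sum_congr rfl fun k _ => ?_
    rw [integral_finsetSum _ fun l _ => hi _ ((hA k).inter (hA l))]
    exact Finset.sum_congr rfl fun l _ => integral_indicator_one ((hA k).inter (hA l))
  have key : ∫ ω, (2 / D * ∑ k, (A k).indicator (1 : Ω → ℝ) ω -
      1 / D ^ 2 * ∑ k, ∑ l, (A k ∩ A l).indicator (1 : Ω → ℝ) ω) ∂μ ≤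
      ∫ ω, (⋃ k, A k).indicator (1 : Ω → ℝ) ω ∂μ := by
    refine integral_mono ((hi1.const_mul _).sub (hi2.const_mul _))
      (hi _ (MeasurableSet.iUnion hA)) fun ω => ?_
    have e3 : ∑ k, ∑ l, (A k ∩ A l).indicator (1 : Ω → ℝ) ω =
        (∑ k, (A k).indicator (1 : Ω → ℝ) ω) ^ 2 := by
      rw [sq, Finset.sum_mul_sum]
      simp only [Set.inter_indicator_one, Pi.mul_apply]
    simp only [e3]
    by_cases hω : ω ∈ ⋃ k, A k
    · rw [Set.indicator_of_mem hω, Pi.one_apply]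
      have := sq_nonneg (1 - 1 / D * ∑ k, (A k).indicator (1 : Ω → ℝ) ω)
      have e4 : (1 - 1 / D * ∑ k, (A k).indicator (1 : Ω → ℝ) ω) ^ 2 =
          1 - (2 / D * ∑ k, (A k).indicator (1 : Ω → ℝ) ω -
            1 / D ^ 2 * (∑ k, (A k).indicator (1 : Ω → ℝ) ω) ^ 2) := by
        ring
      linarith
    · have h0 : ∑ k, (A k).indicator (1 : Ω → ℝ) ω = 0 :=
        Finset.sum_eq_zero fun k _ =>
          Set.indicator_of_notMem (fun hk => hω (Set.mem_iUnion.2 ⟨k, hk⟩)) _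
      rw [Set.indicator_of_notMem hω, h0]
      simp
  rw [integral_sub (hi1.const_mul _) (hi2.const_mul _), integral_const_mul, integral_const_mul,
    e1, e2, integral_indicator_one (MeasurableSet.iUnion hA)] at key
  have h3 : 1 / D ^ 2 * ∑ k, ∑ l, μ.real (A k ∩ A l) ≤ 1 / D ^ 2 * (D * ∑ k, μ.real (A k)) := by
    gcongr
  have e5 : 1 / D ^ 2 * (D * ∑ k, μ.real (A k)) = (∑ k, μ.real (A k)) / D := by
    field_simp
  have e6 : 2 / D * ∑ k, μ.real (A k) = (∑ k, μ.real (A k)) / D + (∑ k, μ.real (A k)) / D := by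
    ring
  linarith

/-- Exponential weights on a grid have bounded row sums. -/
lemma exists_sum_prod_exp_le (d : ℕ) {a : ℝ} (ha : 0 < a) :
    ∃ S : ℝ, 0 < S ∧ ∀ (m : ℕ) (k : Fin d → Fin m),
      ∑ l : Fin d → Fin m, ∏ i, Real.exp (-(a * |((k i : ℕ) : ℝ) - ((l i : ℕ) : ℝ)|)) ≤ S := by
  have hs : Summable fun z : ℤ => Real.exp (-(a * |(z : ℝ)|)) := by
    have h1 : Summable fun n : ℕ => Real.exp (-(a * (n : ℝ))) := by
      have := Real.summable_exp_nat_mul_iff.2 (neg_lt_zero.2 ha)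
      refine this.congr fun n => ?_
      congr 1; ring
    refine Summable.of_nat_of_neg ?_ ?_
    · refine h1.congr fun n => ?_
      simp
    · refine h1.congr fun n => ?_
      simp
  set S := ∑' z : ℤ, Real.exp (-(a * |(z : ℝ)|)) with hS
  have hS0 : 0 < S := hs.tsum_pos (fun _ => (Real.exp_pos _).le) 0 (Real.exp_pos _)
  refine ⟨S ^ d, by positivity, fun m k => ?_⟩
  have h1 : ∀ q : Fin m, ∑ j : Fin m, Real.exp (-(a * |((q : ℕ) : ℝ) - ((j : ℕ) : ℝ)|)) ≤ S := by
    intro q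
    have hinj : Function.Injective fun j : Fin m => ((q : ℕ) : ℤ) - ((j : ℕ) : ℤ) := by
      intro x y hxy
      simp only at hxy
      exact Fin.ext (by omega)
    calc ∑ j : Fin m, Real.exp (-(a * |((q : ℕ) : ℝ) - ((j : ℕ) : ℝ)|))
        = ∑ z ∈ Finset.univ.map ⟨_, hinj⟩, Real.exp (-(a * |(z : ℝ)|)) := by
          rw [Finset.sum_map]
          simp
      _ ≤ S := hs.sum_le_tsum _ fun _ _ => (Real.exp_pos _).le
  calc ∑ l : Fin d → Fin m, ∏ i, Real.exp (-(a * |((k i : ℕ) : ℝ) - ((l i : ℕ) : ℝ)|))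
      = ∏ i, ∑ j : Fin m, Real.exp (-(a * |((k i : ℕ) : ℝ) - ((j : ℕ) : ℝ)|)) := by
        rw [Finset.prod_univ_sum, Fintype.piFinset_univ]
    _ ≤ ∏ _i : Fin d, S := Finset.prod_le_prod
        (fun i _ => Finset.sum_nonneg fun _ _ => (Real.exp_pos _).le) fun i _ => h1 (k i)
    _ = S ^ d := by simp

lemma sum_abs_sub_le_of_grid {d m : ℕ} (hd : 0 < d) {b c : ℝ} (hb0 : 0 < b) (hc : 0 ≤ c)
    {k l : Fin d → Fin m} (hkl : k ≠ l) {v x : Fin d → ℝ}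
    (hv : ∀ i, v i = 8 / b * (((l i : ℕ) : ℝ) - ((k i : ℕ) : ℝ))) (h1 : ‖v - x‖ ≤ 4 / b) :
    (4 * c / d) * ∑ i, |((k i : ℕ) : ℝ) - ((l i : ℕ) : ℝ)| ≤ b ^ 2 * (c * ‖x‖ ^ 2) / 4 := by
  have hd0 : (0 : ℝ) < d := by exact_mod_cast hd
  have hn3 : 8 / b ≤ ‖v‖ := by
    obtain ⟨i, hi⟩ := Function.ne_iff.1 hkl
    refine le_trans ?_ (norm_le_pi_norm _ i)
    rw [hv, Real.norm_eq_abs, abs_mul, abs_of_pos (by positivity : 0 < 8 / b)]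
    have h2 : (1 : ℝ) ≤ |((l i : ℕ) : ℝ) - ((k i : ℕ) : ℝ)| := by
      have h3 : (1 : ℤ) ≤ |((l i : ℕ) : ℤ) - ((k i : ℕ) : ℤ)| := by
        refine Int.one_le_abs ?_
        have : (k i : ℕ) ≠ (l i : ℕ) := fun h => hi (Fin.ext h)
        omega
      exact_mod_cast h3
    have h4 : 0 < 8 / b := by positivity
    nlinarith
  have hn4 : ‖v‖ / 2 ≤ ‖x‖ := by
    have := norm_sub_norm_le (v) x
    have e : 8 / b = 2 * (4 / b) := by ring
    linarith
  have hn5 : ∑ i, |((k i : ℕ) : ℝ) - ((l i : ℕ) : ℝ)| ≤ d * (b / 8 * ‖v‖) := by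
    have h2 : ∀ i ∈ Finset.univ, |((k i : ℕ) : ℝ) - ((l i : ℕ) : ℝ)| ≤ b / 8 * ‖v‖ := by
      intro i _
      have h3 := norm_le_pi_norm (v) i
      rw [hv, Real.norm_eq_abs, abs_mul, abs_of_pos (by positivity : 0 < 8 / b)] at h3
      rw [abs_sub_comm]
      calc |((l i : ℕ) : ℝ) - ((k i : ℕ) : ℝ)|
          = b / 8 * (8 / b * |((l i : ℕ) : ℝ) - ((k i : ℕ) : ℝ)|) := by field_simp
        _ ≤ _ := by gcongr
    have h3 := Finset.sum_le_card_nsmul _ _ _ h2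
    simpa using h3
  have hn6 : 1 ≤ b / 4 * ‖x‖ := by
    have h2 : b / 4 * (8 / b / 2) ≤ b / 4 * ‖x‖ := by
      gcongr
      linarith
    have e : b / 4 * (8 / b / 2) = 1 := by field_simp; norm_num
    linarith
  calc (4 * c / d) * ∑ i, |((k i : ℕ) : ℝ) - ((l i : ℕ) : ℝ)|
      ≤ (4 * c / d) * (d * (b / 8 * ‖v‖)) := by gcongr
    _ = 4 * c * (b / 4 * (‖v‖ / 2)) := by field_simp; ring
    _ ≤ 4 * c * (b / 4 * ‖x‖) := by gcongr
    _ ≤ 4 * c * ((b / 4 * ‖x‖) * (b / 4 * ‖x‖)) := by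
      gcongr 4 * c * ?_
      exact le_mul_of_one_le_left (by positivity) hn6
    _ = b ^ 2 * (c * ‖x‖ ^ 2) / 4 := by ring

variable {Ω : Type} [MeasureSpace Ω] {d : ℕ}

namespace IsHomGaussField

variable {f : (Fin d → ℝ) → Ω → ℝ}

lemma pow_mul_div_le_measure_exists_lt [IsProbabilityMeasure (ℙ : Measure Ω)]
    (hf : IsHomGaussField f) {b a S : ℝ} (hb : 1 ≤ b) {c₁ : ℝ}
    (hc₁0 : 0 < c₁) (hc₁ : c₁ = (√(2 * Real.pi))⁻¹ * Real.exp (-(3 / 2))) (hS : 0 < S) {m : ℕ}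
    (hS' : ∀ k : Fin d → Fin m,
      ∑ l : Fin d → Fin m, ∏ i, Real.exp (-(a * |((k i : ℕ) : ℝ) - ((l i : ℕ) : ℝ)|)) ≤ S)
    (t : (Fin d → Fin m) → Fin d → ℝ)
    (hpair : ∀ k l, a * ∑ i, |((k i : ℕ) : ℝ) - ((l i : ℕ) : ℝ)| ≤
      b ^ 2 * (1 - cov f (t l - t k)) / 4) :
    ((m : ℝ) ^ d * (c₁ * (1 / b * Real.exp (-b ^ 2 / 2)))) / (2 * S / c₁) ≤
      (ℙ : Measure Ω).real {ω | ∃ k, b < f (t k) ω} := by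
  have hb0 : 0 < b := by linarith
  set g := 1 / b * Real.exp (-b ^ 2 / 2) with hg
  have hg0 : 0 < g := by positivity
  set A : (Fin d → Fin m) → Set Ω := fun k => {ω | b < f (t k) ω} with hA
  have hAm : ∀ k, MeasurableSet (A k) := fun k => measurableSet_lt measurable_const (hf.meas _)
  have hAk : ∀ k, (ℙ : Measure Ω).real (A k) = (gaussianReal 0 1).real (Set.Ioi b) := fun k =>
    congrArg ENNReal.toReal (hf.measure_lt_eq (t k) b)
  set q := (gaussianReal 0 1).real (Set.Ioi b) with hq
  have hq1 : c₁ * g ≤ q :=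
    by
    have h1 := ENNReal.toReal_mono (measure_ne_top _ _) (le_gaussianReal_Ioi hb)
    rw [ENNReal.toReal_ofReal (by positivity)] at h1
    rw [hc₁, hg]
    exact h1
  have hAkl : ∀ k l, (ℙ : Measure Ω).real (A k ∩ A l) ≤
      2 * g * ∏ i, Real.exp (-(a * |((k i : ℕ) : ℝ) - ((l i : ℕ) : ℝ)|)) := by
    intro k l
    have h1 := ENNReal.toReal_le_of_le_ofReal (by positivity)
      (hf.measure_lt_and_lt_le (t k) (t l) hb0)
    refine h1.trans ?_
    rw [← Real.exp_sum, Finset.sum_neg_distrib, ← Finset.mul_sum]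
    have e : 2 / b * Real.exp (-b ^ 2 / 2) = 2 * g := by rw [hg]; ring
    rw [e]
    gcongr
    exact hpair k l
  have hsub : ⋃ k, A k = {ω | ∃ k, b < f (t k) ω} := by
    ext ω; simp [hA]
  clear_value A q g
  have hsum : ∑ k, ∑ l, (ℙ : Measure Ω).real (A k ∩ A l) ≤
      (2 * S / c₁) * ∑ k, (ℙ : Measure Ω).real (A k) := by
    rw [Finset.mul_sum]
    refine Finset.sum_le_sum fun k _ => ?_
    rw [hAk]
    refine (Finset.sum_le_sum fun l _ => hAkl k l).trans ?_
    rw [← Finset.mul_sum]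
    calc _ ≤ 2 * g * S := mul_le_mul_of_nonneg_left (hS' k) (by positivity)
      _ = 2 * S / c₁ * (c₁ * g) := by field_simp
      _ ≤ _ := by gcongr
  have hmain := div_le_measure_iUnion_of_sum_inter_le (ℙ : Measure Ω) hAm
    (by positivity : 0 < 2 * S / c₁) hsum
  refine le_trans ?_ (hmain.trans_eq (congrArg _ hsub))
  simp only [hAk, Finset.sum_const, Finset.card_univ, Fintype.card_pi, Fintype.card_fin,
    Finset.prod_const, nsmul_eq_mul, Nat.cast_pow]
  gcongr

lemma exists_le_measure_exists_lt [IsProbabilityMeasure (ℙ : Measure Ω)]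
    (hf : IsHomGaussField f) (hd : 0 < d)
    {T : Set (Fin d → ℝ)} (hT : Bornology.IsBounded T) (hTint : (interior T).Nonempty)
    (huniq : ∀ᵐ ω ∂(ℙ : Measure Ω), ∃! t, t ∈ T ∧ ∀ s ∈ T, f s ω ≤ f t ω) :
    ∃ c : ℝ, 0 < c ∧ ∃ b₁ : ℝ, 1 ≤ b₁ ∧ ∀ b : ℝ, b₁ < b → ∀ ε : ℝ, 0 < ε → ε ≤ 1 →
      ∀ (M : ℕ) (ts : Fin M → (Fin d → ℝ)),
      (∀ t ∈ T, ∃ i, nrm (ts i - t) ≤ 2 * (ε / b)) →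
      c * (b ^ d * (1 / b * Real.exp (-b ^ 2 / 2))) ≤
        (ℙ {ω | ∃ k, f (ts k) ω > b}).toReal := by
  obtain ⟨ρ, hρ, hcov⟩ := hf.exists_cov_lt_one hT hTint huniq
  obtain ⟨c, hc, hcb⟩ := hf.exists_le_one_sub_cov hρ hcov
  have hd0 : (0 : ℝ) < d := by exact_mod_cast hd
  obtain ⟨S, hS, hSum⟩ := exists_sum_prod_exp_le d (a := 4 * c / d) (by positivity)
  obtain ⟨w, hw⟩ := hTint
  obtain ⟨r, hr, hball⟩ := Metric.isOpen_iff.1 isOpen_interior w hw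
  obtain ⟨η, hη, hηr, hηρ⟩ : ∃ η : ℝ, 0 < η ∧ η < r ∧ η ≤ ρ / 8 :=
    ⟨min (r / 2) (ρ / 8), by positivity, (min_le_left _ _).trans_lt (by linarith),
      min_le_right _ _⟩
  set c₁ := (√(2 * Real.pi))⁻¹ * Real.exp (-(3 / 2)) with hc₁
  have hc₁0 : 0 < c₁ := by positivity
  refine ⟨(η / 8) ^ d * c₁ / (2 * S / c₁), by positivity, max 1 (32 / ρ), le_max_left _ _,
    fun b hb ε hε hε1 M ts hcover => ?_⟩
  have hb1 : 1 < b := (le_max_left _ _).trans_lt hb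
  have hb0 : 0 < b := by linarith
  have hbρ : 4 / b ≤ ρ / 8 := by
    have := (le_max_right _ _).trans_lt hb
    rw [div_lt_iff₀ hρ] at this
    rw [div_le_iff₀ hb0]
    linarith
  set g := 1 / b * Real.exp (-b ^ 2 / 2) with hg
  have hg0 : 0 < g := by positivity
  set m := ⌊b * η / 8⌋₊ + 1 with hm
  have hm1 : b * η / 8 ≤ m := by
    rw [hm]; push_cast; exact (Nat.lt_floor_add_one _).le
  have hkm : ∀ q : Fin m, 8 / b * ((q : ℕ) : ℝ) ≤ η := by
    intro q
    have h1 : ((q : ℕ) : ℝ) ≤ (⌊b * η / 8⌋₊ : ℝ) := by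
      exact_mod_cast Nat.le_of_lt_succ q.2
    have h2 := h1.trans (Nat.floor_le (by positivity))
    rw [div_mul_eq_mul_div, div_le_iff₀ hb0]
    linarith
  set y : (Fin d → Fin m) → Fin d → ℝ := fun k i => w i + 8 / b * ((k i : ℕ) : ℝ) with hy
  have hyT : ∀ k, y k ∈ T := by
    intro k
    refine interior_subset (hball ?_)
    rw [Metric.mem_ball, dist_eq_norm]
    refine lt_of_le_of_lt ((pi_norm_le_iff_of_nonneg hη.le).2 fun i => ?_) hηr
    have : (y k - w) i = 8 / b * ((k i : ℕ) : ℝ) := by simp [hy]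
    rw [this, Real.norm_of_nonneg (by positivity)]
    exact hkm _
  choose I hI using fun k => hcover (y k) (hyT k)
  have hIn : ∀ k, ‖ts (I k) - y k‖ ≤ 2 / b := fun k => by
    refine (norm_le_nrm _).trans ((hI k).trans ?_)
    rw [mul_div_assoc']
    gcongr
    linarith
  have hdist : ∀ k l, k ≠ l → ‖(y l - y k) - (ts (I l) - ts (I k))‖ ≤ 4 / b := fun k l _ => by
    have e : (y l - y k) - (ts (I l) - ts (I k)) = (ts (I k) - y k) - (ts (I l) - y l) := by abel
    rw [e]
    refine (norm_sub_le _ _).trans ((add_le_add (hIn k) (hIn l)).trans_eq ?_)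
    ring
  have hpair : ∀ k l, (4 * c / d) * ∑ i, |((k i : ℕ) : ℝ) - ((l i : ℕ) : ℝ)| ≤
      b ^ 2 * (1 - cov f (ts (I l) - ts (I k))) / 4 := by
    intro k l
    rcases eq_or_ne k l with rfl | hkl
    · simp [hf.cov_zero]
    have h1 := hdist k l hkl
    have hyl : ∀ i, (y l - y k) i = 8 / b * (((l i : ℕ) : ℝ) - ((k i : ℕ) : ℝ)) := fun i => by
      simp [hy]; ring
    set x := ts (I l) - ts (I k) with hx
    have hn1 : ‖y l - y k‖ ≤ η := by
      refine (pi_norm_le_iff_of_nonneg hη.le).2 fun i => ?_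
      rw [hyl, Real.norm_eq_abs, abs_le, mul_sub]
      have p1 := hkm (l i)
      have p2 := hkm (k i)
      have p3 : 0 ≤ 8 / b * ((l i : ℕ) : ℝ) := by positivity
      have p4 : 0 ≤ 8 / b * ((k i : ℕ) : ℝ) := by positivity
      constructor <;> linarith
    have hn2 : ‖x‖ ≤ ρ / 4 := by
      have := norm_sub_norm_le x (y l - y k)
      have e := norm_sub_rev x (y l - y k)
      linarith
    refine (sum_abs_sub_le_of_grid hd hb0 hc.le hkl hyl h1).trans ?_
    have := hcb x hn2
    gcongr
  have hmain := hf.pow_mul_div_le_measure_exists_lt hb1.le hc₁0 hc₁ hS (hSum m)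
    (fun k => ts (I k)) hpair
  have hsub : {ω | ∃ k, b < f (ts (I k)) ω} ⊆ {ω | ∃ k, f (ts k) ω > b} :=
    fun ω ⟨k, hk⟩ => ⟨I k, hk⟩
  refine le_trans ?_ (hmain.trans (measureReal_mono hsub))
  rw [div_mul_eq_mul_div]
  gcongr ?_ / _
  calc (η / 8) ^ d * c₁ * (b ^ d * g) = (b * η / 8) ^ d * (c₁ * g) := by
        rw [mul_div_assoc, mul_pow]; ring
    _ ≤ _ := by gcongr

end IsHomGaussField

end LowerBound

section SecondMoment

open scoped ENNReal NNReal Topology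

variable {Ω : Type} [MeasureSpace Ω] {d : ℕ}

/-- The second moment of the importance sampling estimator for the exceedance of a level `b` by a
finite family with common tail probability `p` at the level `a ≤ b`. -/
lemma mean_integral_sq_cond_eq [IsProbabilityMeasure (ℙ : Measure Ω)] {M : ℕ} (hM : 0 < M)
    {X : Fin M → Ω → ℝ} (hX : ∀ i, Measurable (X i)) {a b p : ℝ} (hab : a ≤ b) (hp : 0 < p)
    (hXp : ∀ i, (ℙ {ω | X i ω > a}).toReal = p) :
    ((1 : ℝ) / (M : ℝ)) * ∑ i : Fin M,
      ∫ ω, (if ∃ k, X k ω > b then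
          (M : ℝ) * p / ((Finset.univ.filter fun j : Fin M => X j ω > a).card : ℝ) else 0) ^ 2
        ∂((ℙ : Measure Ω)[|{ω | X i ω > a}]) =
    (M : ℝ) * p * (∫⁻ ω in {ω | ∃ k, X k ω > b},
      ENNReal.ofReal (1 / ((Finset.univ.filter fun j : Fin M => X j ω > a).card : ℝ))).toReal := by
  have hM0 : (0 : ℝ) < M := by exact_mod_cast hM
  set N : Ω → ℝ := fun ω => ((Finset.univ.filter fun j : Fin M => X j ω > a).card : ℝ) with hN
  set B : Set Ω := {ω | ∃ k, X k ω > b} with hB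
  have hAm : ∀ i, MeasurableSet {ω | X i ω > a} := fun i =>
    measurableSet_lt measurable_const (hX i)
  have hBm : MeasurableSet B := by
    have : B = ⋃ k, {ω | X k ω > b} := by ext ω; simp [hB]
    rw [this]
    exact MeasurableSet.iUnion fun k => measurableSet_lt measurable_const (hX k)
  have hNsum : ∀ ω, N ω = ∑ i, {ω | X i ω > a}.indicator (1 : Ω → ℝ) ω := fun ω => by
    simp only [hN, Finset.card_filter, Nat.cast_sum, Set.indicator_apply, Set.mem_ofPred_eq,
      Pi.one_apply, Nat.cast_ite, Nat.cast_one, Nat.cast_zero]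
  have hNm : Measurable N := by
    have : N = fun ω => ∑ i, {ω | X i ω > a}.indicator (1 : Ω → ℝ) ω := funext hNsum
    rw [this]
    exact Finset.measurable_fun_sum _ fun i _ => measurable_one.indicator (hAm i)
  have hN0 : ∀ ω, 0 ≤ N ω := fun ω => Nat.cast_nonneg _
  have hN1 : ∀ ω ∈ B, 1 ≤ N ω := by
    rintro ω ⟨k, hk⟩
    have : 0 < (Finset.univ.filter fun j : Fin M => X j ω > a).card :=
      Finset.card_pos.2 ⟨k, by simpa using lt_of_le_of_lt hab hk⟩
    exact Nat.one_le_cast.2 this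
  set F : Ω → ℝ := fun ω => (if ω ∈ B then (M : ℝ) * p / N ω else 0) ^ 2 with hF
  have hFm : Measurable F :=
    (Measurable.ite hBm (measurable_const.div hNm) measurable_const).pow_const 2
  have hFb : ∀ ω, ‖F ω‖ ≤ (M * p) ^ 2 := fun ω => by
    rw [Real.norm_of_nonneg (sq_nonneg _)]
    by_cases hω : ω ∈ B
    · simp only [if_pos hω]
      have := div_le_self (by positivity : 0 ≤ M * p) (hN1 ω hω)
      have h0 : 0 ≤ M * p / N ω := div_nonneg (by positivity) (hN0 ω)
      gcongr
    · simp only [if_neg hω]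
      exact pow_le_pow_left₀ le_rfl (by positivity) 2
  have hFi : Integrable F ℙ :=
    Integrable.of_bound hFm.aestronglyMeasurable _ (Eventually.of_forall hFb)
  have hcond : ∀ i, ∫ ω, F ω ∂((ℙ : Measure Ω)[|{ω | X i ω > a}]) =
      p⁻¹ * ∫ ω, {ω | X i ω > a}.indicator (1 : Ω → ℝ) ω * F ω := fun i => by
    rw [ProbabilityTheory.cond, integral_smul_measure, ENNReal.toReal_inv, hXp, smul_eq_mul,
      ← integral_indicator (hAm i)]
    congr 2
    ext ω
    simp [Set.indicator_apply]
  have hlin : ∫ ω, N ω * F ω = ∫ ω in B, (M * p) ^ 2 * (1 / N ω) := by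
    rw [← integral_indicator hBm]
    congr 1
    ext ω
    by_cases hω : ω ∈ B
    · have := hN1 ω hω
      have h0 : N ω ≠ 0 := by linarith
      rw [Set.indicator_of_mem hω]
      simp only [hF, if_pos hω]
      field_simp
    · rw [Set.indicator_of_notMem hω]
      simp [hF, hω]
  have hgoal : ∑ i, ∫ ω, F ω ∂((ℙ : Measure Ω)[|{ω | X i ω > a}]) =
      p⁻¹ * ((M * p) ^ 2 * ∫ ω in B, 1 / N ω) := by
    rw [← integral_const_mul, ← hlin]
    simp only [hcond]
    rw [← Finset.mul_sum, ← integral_finsetSum]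
    · congr 2
      ext ω
      rw [hNsum, Finset.sum_mul]
    · intro i _
      refine (hFi.indicator (hAm i)).congr (Eventually.of_forall fun ω => ?_)
      simp [Set.indicator_apply]
  have hI_int : ∫ ω in B, 1 / N ω = (∫⁻ ω in B, ENNReal.ofReal (1 / N ω)).toReal :=
    integral_eq_lintegral_of_nonneg_ae
      (Eventually.of_forall fun ω => one_div_nonneg.2 (hN0 ω))
      (measurable_const.div hNm).aestronglyMeasurable
  change 1 / (M : ℝ) * ∑ i, ∫ ω, F ω ∂((ℙ : Measure Ω)[|{ω | X i ω > a}]) =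
    M * p * (∫⁻ ω in B, ENNReal.ofReal (1 / N ω)).toReal
  rw [hgoal, hI_int]
  field_simp

end SecondMoment

/-- Theorem `ThmBdRelHom`: strong variance control.  Under Conditions
B1–B2, for a finite `(ε/b)`-regular discretization `T̃ = {t₁,…,t_M}` of `T`, let
`X = (f(t₁),…,f(t_M))`, let `Q(X ∈ B) = (1/M) ∑ᵢ P(X ∈ B | Xᵢ > b − 1/b)`, and
`L̃_b = M P(X₁ > b − 1/b)/(∑ⱼ 1(Xⱼ > b − 1/b)) · 1(maxᵢ Xᵢ > b)`.  Then there are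
`c, b₀, ε₀ > 0` such that for all `b > b₀`, `ε ∈ (0,ε₀]` and all such discretizations,
`E^Q[L̃_b²] ≤ c P(sup_{t∈T̃} f(t) > b)² ≤ c P(sup_{t∈T} f(t) > b)²`
(the expectation `E^Q[L̃_b²]` being written out as `(1/M) ∑ᵢ E[L̃_b² | Xᵢ > b − 1/b]`). -/
theorem strong_variance_control_smooth_homogeneous
    {Ω : Type} [MeasureSpace Ω] [IsProbabilityMeasure (ℙ : Measure Ω)]
    {d : ℕ} (hd : 0 < d)
    -- Condition B2: `T` is a compact convex `d`-dimensional set with nonempty interior,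
    -- containing `0`, whose boundary is a `(d−1)`-dimensional manifold without boundary,
    -- and which has non-degenerate volume near every point
    (T : Set (Fin d → ℝ)) (hTcompact : IsCompact T) (hTconv : Convex ℝ T)
    (hTint : (interior T).Nonempty) (h0T : (0 : Fin d → ℝ) ∈ T)
    (hTbdry : Nonempty (frontier T ≃ₜ Metric.sphere (0 : EuclideanSpace ℝ (Fin d)) 1))
    (κ₀ : ℝ) (hκ₀ : 0 < κ₀)
    (hB2 : ∀ t ∈ T, ∀ ε : ℝ, 0 < ε → ε < 1 →
      κ₀ * ε ^ d ≤ (volume ({s | nrm (s - t) ≤ ε} ∩ T)).toReal)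
    -- Condition B1: `f` is a centered, unit-variance, homogeneous Gaussian field,
    -- almost surely twice continuously differentiable
    (f : (Fin d → ℝ) → Ω → ℝ) (hfmeas : ∀ t, Measurable (f t))
    (hGauss : ∀ (n : ℕ) (t : Fin n → (Fin d → ℝ)) (c : Fin n → ℝ),
      ∃ v : NNReal,
        Measure.map (fun ω => ∑ i, c i * f (t i) ω) (ℙ : Measure Ω) = gaussianReal 0 v)
    (hvar : (∫ ω, (f 0 ω) ^ 2) = 1)
    (hstat : ∀ (n : ℕ) (t : Fin n → (Fin d → ℝ)) (h : Fin d → ℝ),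
      Measure.map (fun ω (i : Fin n) => f (t i + h) ω) (ℙ : Measure Ω) =
        Measure.map (fun ω (i : Fin n) => f (t i) ω) (ℙ : Measure Ω))
    (hsmooth : ∀ᵐ ω ∂(ℙ : Measure Ω), ContDiff ℝ 2 (fun t => f t ω))
    -- nondegeneracy: the global maximum over `T` is a.s. attained at a unique point
    (huniq : ∀ᵐ ω ∂(ℙ : Measure Ω), ∃! t, t ∈ T ∧ ∀ s ∈ T, f s ω ≤ f t ω)
    :
    ∃ c b₀ ε₀ : ℝ, 0 < c ∧ 0 < b₀ ∧ 0 < ε₀ ∧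
      ∀ b : ℝ, b₀ < b → ∀ ε : ℝ, 0 < ε → ε ≤ ε₀ →
        ∀ (M : ℕ) (hM : 0 < M) (ts : Fin M → (Fin d → ℝ)),
          (∀ i, ts i ∈ T) →
          (∀ i j : Fin M, i ≠ j → ε / b ≤ nrm (ts i - ts j)) →
          (∀ t ∈ T, ∃ i, nrm (ts i - t) ≤ 2 * (ε / b)) →
          (((1 : ℝ) / (M : ℝ)) * ∑ i : Fin M,
              ∫ ω, (if ∃ k, f (ts k) ω > b then
                    (M : ℝ) * (ℙ {ω' | f (ts ⟨0, hM⟩) ω' > b - 1 / b}).toReal /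
                      ((Finset.univ.filter fun j : Fin M =>
                          f (ts j) ω > b - 1 / b).card : ℝ)
                  else 0) ^ 2
                ∂((ℙ : Measure Ω)[|{ω | f (ts i) ω > b - 1 / b}])
            ≤ c * (ℙ {ω | ∃ i, f (ts i) ω > b}).toReal ^ 2) ∧
          (ℙ {ω | ∃ i, f (ts i) ω > b}).toReal ≤
            (ℙ {ω | ∃ t ∈ T, f t ω > b}).toReal := by
  have hf : IsHomGaussField f := ⟨hfmeas, hGauss, hvar, hstat, hsmooth⟩
  have hTb := hTcompact.isBounded
  obtain ⟨C₁, hC₁, hcard⟩ := exists_card_le_of_separated hd hTb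
  obtain ⟨C₂, hC₂, b₁, hb₁, hup⟩ := hf.exists_lintegral_one_div_card_le hTb hκ₀ hB2
  obtain ⟨c₃, hc₃, b₂, hb₂, hlow⟩ := hf.exists_le_measure_exists_lt hd hTb hTint huniq
  refine ⟨C₁ * (2 * Real.exp 1) * C₂ / c₃ ^ 2, max b₁ b₂, 1, by positivity,
    lt_max_of_lt_left (by linarith), one_pos,
    fun b hb ε hε hε1 M hM ts hts hsep hcov => ⟨?_, ?_⟩⟩
  · have hbb₁ : b₁ < b := (le_max_left _ _).trans_lt hb
    have hbb₂ : b₂ < b := (le_max_right _ _).trans_lt hb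
    have hb1 : 1 < b := hb₁.trans_lt hbb₁
    have hb0 : 0 < b := by linarith
    set p := (ℙ {ω' | f (ts ⟨0, hM⟩) ω' > b - 1 / b}).toReal with hp
    have hpq : ∀ i, (ℙ {ω | f (ts i) ω > b - 1 / b}).toReal =
        (gaussianReal 0 1 (Set.Ioi (b - 1 / b))).toReal := fun i =>
      congrArg ENNReal.toReal (hf.measure_lt_eq (ts i) (b - 1 / b))
    have hb' : b - 1 / b ≤ b := by
      have : 0 < 1 / b := by positivity
      linarith
    have hp0 : 0 < p := by
      rw [hp, hpq]
      refine ENNReal.toReal_pos (ne_of_gt ?_) (measure_ne_top _ _)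
      refine lt_of_lt_of_le ?_ (measure_mono (Set.Ioi_subset_Ioi hb'))
      refine lt_of_lt_of_le ?_ (le_gaussianReal_Ioi hb1.le)
      exact ENNReal.ofReal_pos.2 (by positivity)
    set g := 1 / b * Real.exp (-b ^ 2 / 2) with hg
    have hg0 : 0 < g := by positivity
    have hpg : p ≤ 2 * Real.exp 1 * g := by
      rw [hp, hpq]
      refine (ENNReal.toReal_le_of_le_ofReal (by positivity)
        (gaussianReal_Ioi_le hb0 (b - 1 / b))).trans_eq ?_
      have e : b ^ 2 / 2 - b * (b - 1 / b) = 1 + -b ^ 2 / 2 := by field_simp; ring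
      rw [e, Real.exp_add, hg]
      ring
    rw [mean_integral_sq_cond_eq hM (fun i => hfmeas (ts i)) hb' hp0
      fun i => (hpq i).trans (hpq ⟨0, hM⟩).symm]
    have h1 := ENNReal.toReal_le_of_le_ofReal (by positivity) (hup b hbb₁ ε hε M ts hts hcov)
    have h2 := hcard b hb1.le ε hε hε1 M ts hts hsep
    have h3 := hlow b hbb₂ ε hε hε1 M ts hcov
    calc _ ≤ (C₁ * (b / ε) ^ d) * (2 * Real.exp 1 * g) * (C₂ * (ε ^ d * b ^ d * g)) := by gcongr
      _ = C₁ * (2 * Real.exp 1) * C₂ / c₃ ^ 2 * (c₃ * (b ^ d * g)) ^ 2 := by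
        rw [div_pow]; field_simp
      _ ≤ _ := by gcongr
  · exact ENNReal.toReal_mono (measure_ne_top _ _)
      (measure_mono fun ω ⟨i, hi⟩ => ⟨ts i, hts i, hi⟩)
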